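/- arXiv:1602.06922 — 4 statements merged into one kernel-verified Lean document; each statement's English description precedes it below -/
import Mathlib

section
/- For every γ ≥ 1 there exist constants C(γ) > 0 and C'(γ) > 0 such that the following holds for every d = 2^n with d ≥ 16 and every pair of unit vectors x, y ∈ S^{d−1}. Let m = ⌈C(γ) (ln d)^4 (ln ln d)^4⌉ (assume m ≤ d), let S be a uniformly random subset of {1,…,d} of size m, let D_b be a diagonal matrix with i.i.d. Rademacher diagonal entries independent of S, and set x̃ = (1/√m) H_S D_b x and ỹ = (1/√m) H_S D_b y. Then with probability at least 1 − C'(γ) d^{−γ}, all three of the following hold: (1 − 1/ln d) ≤ ‖x̃‖₂² ≤ (1 + 1/ln d); (1 − 1/ln d) ≤ ‖ỹ‖₂² ≤ (1 + 1/ln d); and (1 − 1/ln d)‖x − y‖₂² ≤ ‖x̃ − ỹ‖₂² ≤ (1 + 1/ln d)‖x − y‖₂². -/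
open MeasureTheory
open scoped ENNReal

/-- The uniform probability measure on a finite type (normalized counting measure). -/
noncomputable def uniformCount (α : Type*) [MeasurableSpace α] : Measure α :=
  (Nat.card α : ℝ≥0∞)⁻¹ • Measure.count

/-- Entry `(i,j)` of the `2^n × 2^n` Hadamard matrix: `(−1)^{⟨i,j⟩}` where `⟨i,j⟩` is the
`F₂` inner product of the binary expansions of `i` and `j`. -/
noncomputable def hadamardEntry (n : ℕ) (i j : Fin (2 ^ n)) : ℝ :=
  (-1 : ℝ) ^ (∑ k ∈ Finset.range n, ((i : ℕ) >>> k) % 2 * (((j : ℕ) >>> k) % 2))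

/-- The sign `±1` associated to a Rademacher bit. -/
def signOf (b : Bool) : ℝ := if b then 1 else -1

/-- `x̃ = (1/√m) H_S D_b x`: the fast JL embedding of `x ∈ ℝ^{2^n}` into `ℝ^m`, where the
`m`-element subset `S` is encoded by the strictly monotone map `σ : Fin m → Fin 2^n` and the
Rademacher signs by `b`. -/
noncomputable def fastEmbed (n m : ℕ) (σ : Fin m → Fin (2 ^ n)) (b : Fin (2 ^ n) → Bool)
    (x : Fin (2 ^ n) → ℝ) (j : Fin m) : ℝ :=
  (Real.sqrt m)⁻¹ * ∑ k, hadamardEntry n (σ j) k * signOf (b k) * x k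

/-- The joint law of a uniformly random `m`-element subset of `{1,…,2^n}` (encoded as a
strictly monotone map `Fin m → Fin 2^n`) and i.i.d. Rademacher signs. -/
noncomputable def jlMeasure (n m : ℕ) :
    Measure ({σ : Fin m → Fin (2 ^ n) // StrictMono σ} × (Fin (2 ^ n) → Bool)) :=
  (uniformCount {σ : Fin m → Fin (2 ^ n) // StrictMono σ}).prod
    (uniformCount (Fin (2 ^ n) → Bool))

open Finset in
/-- A Markov-type bound for the uniform measure on a finite type. -/
lemma uniformCount_le_of_sum_le {α : Type*} [Fintype α] [Nonempty α] [MeasurableSpace α]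
    [MeasurableSingletonClass α] {s : Set α} {f : α → ℝ} {c : ℝ} (hf : ∀ a, 0 ≤ f a)
    (hs : ∀ a ∈ s, 1 ≤ f a) (hc : ∑ a, f a ≤ c * Fintype.card α) :
    uniformCount α s ≤ ENNReal.ofReal c := by
  classical
  have hcard : ((#{a | a ∈ s} : ℕ) : ℝ) ≤ c * Fintype.card α := by
    refine le_trans ?_ hc
    rw [card_eq_sum_ones, Nat.cast_sum, sum_filter]
    refine sum_le_sum fun a _ ↦ ?_
    split_ifs with h
    · simpa using hs a h
    · exact hf a
  have hpos : (0 : ℝ) < Fintype.card α := by exact_mod_cast Fintype.card_pos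
  have hcount : Measure.count s = ((#{a | a ∈ s} : ℕ) : ℝ≥0∞) := by
    rw [← Measure.count_apply_finset]
    congr 1
    ext a
    simp
  rw [uniformCount, Measure.smul_apply, hcount, smul_eq_mul, Nat.card_eq_fintype_card,
    mul_comm, ← div_eq_mul_inv]
  refine ENNReal.div_le_of_le_mul ?_
  rw [← ENNReal.ofReal_natCast, ← ENNReal.ofReal_natCast (Fintype.card α),
    ← ENNReal.ofReal_mul' hpos.le]
  exact ENNReal.ofReal_le_ofReal hcard

instance isProbabilityMeasure_uniformCount {α : Type*} [Fintype α] [Nonempty α]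
    [MeasurableSpace α] [MeasurableSingletonClass α] :
    IsProbabilityMeasure (uniformCount α) := by
  refine ⟨?_⟩
  rw [uniformCount, Measure.smul_apply, Measure.count_univ, smul_eq_mul,
    ENat.card_eq_coe_natCard]
  exact ENNReal.inv_mul_cancel (by simp) (by simp)

/-- Union bound over the second factor of a product of probability measures. -/
lemma prod_measure_le_add {α β : Type*} [MeasurableSpace α] [MeasurableSpace β]
    [DiscreteMeasurableSpace β] [DiscreteMeasurableSpace (α × β)] {μ : Measure α} {ν : Measure β}
    [IsProbabilityMeasure μ] [IsProbabilityMeasure ν] {s : Set (α × β)} {t : Set β}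
    {p q : ℝ≥0∞} (ht : ν t ≤ p) (hs : ∀ b ∉ t, μ {a | (a, b) ∈ s} ≤ q) :
    (μ.prod ν) s ≤ p + q := by
  rw [Measure.prod_apply_symm (MeasurableSet.of_discrete)]
  calc ∫⁻ b, μ ((fun a ↦ (a, b)) ⁻¹' s) ∂ν
      ≤ ∫⁻ b, (t.indicator (fun _ ↦ 1) b + q) ∂ν := by
        refine lintegral_mono fun b ↦ ?_
        by_cases hb : b ∈ t
        · simpa [hb] using le_add_right prob_le_one
        · rw [Set.indicator_of_notMem hb, zero_add]
          exact hs b hb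
    _ = ν t + q := by
        rw [lintegral_add_right _ measurable_const, lintegral_indicator MeasurableSet.of_discrete]
        simp
    _ ≤ p + q := by gcongr

section Maclaurin

open Finset

variable {ι : Type*} [Fintype ι] [DecidableEq ι]

lemma sum_powersetCard_filter_notMem_antivary {w : ι → ℝ} (hw : ∀ i, 0 ≤ w i) (m : ℕ) :
    Antivary w fun i ↦ ∑ s ∈ powersetCard m univ with i ∉ s, ∏ a ∈ s, w a := by
  intro i j hij
  contrapose! hij
  have hswap : ∑ s ∈ powersetCard m univ with j ∉ s, ∏ a ∈ s, w a =
      ∑ s ∈ powersetCard m univ with i ∉ s, ∏ a ∈ s, w (Equiv.swap i j a) := by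
    refine sum_bij' (fun s _ ↦ s.map (Equiv.swap i j).toEmbedding)
      (fun s _ ↦ s.map (Equiv.swap i j).toEmbedding) ?_ ?_ ?_ ?_ ?_
    · intro s hs
      simp only [mem_filter, mem_powersetCard_univ, card_map, mem_map_equiv, Equiv.symm_swap,
        Equiv.swap_apply_left] at hs ⊢
      exact hs
    · intro s hs
      simp only [mem_filter, mem_powersetCard_univ, card_map, mem_map_equiv, Equiv.symm_swap,
        Equiv.swap_apply_right] at hs ⊢
      exact hs
    · intro s _; ext a; simp [mem_map_equiv]
    · intro s _; ext a; simp [mem_map_equiv]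
    · intro s _; simp [prod_map]
  rw [hswap]
  refine sum_le_sum fun s hs ↦ prod_le_prod (fun a _ ↦ hw _) fun a ha ↦ ?_
  have hai : a ≠ i := by
    rintro rfl
    exact (mem_filter.1 hs).2 ha
  by_cases haj : a = j
  · subst haj; simpa using hij.le
  · rw [Equiv.swap_apply_of_ne_of_ne hai haj]

lemma sum_sum_powersetCard_filter_notMem (w : ι → ℝ) (m : ℕ) :
    ∑ i, ∑ s ∈ powersetCard m univ with i ∉ s, ∏ a ∈ s, w a =
      ((Fintype.card ι : ℝ) - m) * ∑ s ∈ powersetCard m univ, ∏ a ∈ s, w a := by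
  simp_rw [sum_filter]
  rw [sum_comm, mul_sum]
  refine sum_congr rfl fun s hs ↦ ?_
  rw [← sum_filter, sum_const, nsmul_eq_mul, filter_notMem_eq_sdiff, ← compl_eq_univ_sdiff,
    card_compl, Nat.cast_sub (card_le_univ s), mem_powersetCard_univ.1 hs]

lemma sum_mul_sum_powersetCard_filter_notMem (w : ι → ℝ) (m : ℕ) :
    ∑ i, w i * ∑ s ∈ powersetCard m univ with i ∉ s, ∏ a ∈ s, w a =
      (m + 1) * ∑ s ∈ powersetCard (m + 1) univ, ∏ a ∈ s, w a := by
  have hrhs : (m + 1) * ∑ s ∈ powersetCard (m + 1) univ, ∏ a ∈ s, w a =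
      ∑ i, ∑ s ∈ powersetCard (m + 1) univ with i ∈ s, ∏ a ∈ s, w a := by
    simp_rw [sum_filter]
    rw [sum_comm, mul_sum]
    refine sum_congr rfl fun s hs ↦ ?_
    rw [← sum_filter, sum_const, nsmul_eq_mul, filter_univ_mem, mem_powersetCard_univ.1 hs]
    push_cast
    rfl
  rw [hrhs]
  refine sum_congr rfl fun i _ ↦ ?_
  rw [mul_sum]
  refine sum_bij' (fun s _ ↦ insert i s) (fun s _ ↦ s.erase i) ?_ ?_ ?_ ?_ ?_
  · intro s hs
    simp only [mem_filter, mem_powersetCard_univ] at hs ⊢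
    exact ⟨by rw [card_insert_of_notMem hs.2, hs.1], mem_insert_self i s⟩
  · intro s hs
    simp only [mem_filter, mem_powersetCard_univ] at hs ⊢
    exact ⟨by rw [card_erase_of_mem hs.2, hs.1, Nat.add_sub_cancel], notMem_erase i s⟩
  · intro s hs
    exact erase_insert (mem_filter.1 hs).2
  · intro s hs
    exact insert_erase (mem_filter.1 hs).2
  · intro s hs
    rw [prod_insert (mem_filter.1 hs).2]

/-- Maclaurin's inequality comparing an elementary symmetric mean with the arithmetic mean. -/
lemma sum_powersetCard_prod_le [Nonempty ι] {w : ι → ℝ} (hw : ∀ i, 0 ≤ w i) {m : ℕ}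
    (hm : m ≤ Fintype.card ι) :
    ∑ s ∈ powersetCard m univ, ∏ a ∈ s, w a ≤
      (Fintype.card ι).choose m * ((∑ i, w i) / Fintype.card ι) ^ m := by
  have hd : (0 : ℝ) < Fintype.card ι := by exact_mod_cast Fintype.card_pos
  induction m with
  | zero => simp
  | succ m ih =>
    have hcheb := (sum_powersetCard_filter_notMem_antivary hw m).card_mul_sum_le_sum_mul_sum
    rw [sum_sum_powersetCard_filter_notMem, sum_mul_sum_powersetCard_filter_notMem] at hcheb
    have hmd : (0 : ℝ) ≤ Fintype.card ι - m := by
      have : ((m + 1 : ℕ) : ℝ) ≤ Fintype.card ι := by exact_mod_cast hm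
      push_cast at this
      linarith
    have hchoose : ((Fintype.card ι).choose (m + 1) : ℝ) * (m + 1) =
        (Fintype.card ι).choose m * (Fintype.card ι - m) := by
      have h := Nat.choose_succ_right_eq (Fintype.card ι) m
      have h' := congrArg (Nat.cast : ℕ → ℝ) h
      push_cast [Nat.cast_sub (Nat.le_of_succ_le hm)] at h'
      exact h'
    have hW : 0 ≤ ∑ i, w i := sum_nonneg fun i _ ↦ hw i
    have hmpos : (0 : ℝ) < m + 1 := by positivity
    have ih' := mul_le_mul_of_nonneg_left (ih (Nat.le_of_succ_le hm)) (mul_nonneg hW hmd)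
    refine le_of_mul_le_mul_left ?_ (mul_pos hd hmpos)
    calc Fintype.card ι * (m + 1 : ℝ) * ∑ s ∈ powersetCard (m + 1) univ, ∏ a ∈ s, w a
        ≤ (∑ i, w i) * (Fintype.card ι - m) *
            ((Fintype.card ι).choose m * ((∑ i, w i) / Fintype.card ι) ^ m) := by linarith
      _ = (∑ i, w i) * ((∑ i, w i) / Fintype.card ι) ^ m *
            ((Fintype.card ι).choose (m + 1) * (m + 1)) := by rw [hchoose]; ring
      _ = _ := by rw [pow_succ]; field_simp

end Maclaurin

open Finset in
lemma sum_strictMono_eq_sum_powersetCard {N m : ℕ} (F : Finset (Fin N) → ℝ) :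
    ∑ σ : {σ : Fin m → Fin N // StrictMono σ}, F (univ.image σ.1) =
      ∑ s ∈ powersetCard m univ, F s := by
  refine sum_bij (fun σ _ ↦ univ.image σ.1) ?_ ?_ ?_ ?_
  · intro σ _
    rw [mem_powersetCard_univ, card_image_of_injective _ σ.2.injective, card_univ,
      Fintype.card_fin]
  · intro σ _ τ _ h
    refine Subtype.ext ((StrictMono.range_inj σ.2 τ.2).1 ?_)
    simpa using congrArg (fun s : Finset (Fin N) ↦ (s : Set (Fin N))) h
  · intro s hs
    have hs' := mem_powersetCard_univ.1 hs
    exact ⟨⟨s.orderEmbOfFin hs', (s.orderEmbOfFin hs').strictMono⟩, mem_univ _,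
      image_orderEmbOfFin_univ s hs'⟩
  · intro σ _
    rfl

open Finset in
lemma card_strictMono_fin {N m : ℕ} :
    (Fintype.card {σ : Fin m → Fin N // StrictMono σ} : ℝ) = N.choose m := by
  have h := sum_strictMono_eq_sum_powersetCard (N := N) (m := m) fun _ ↦ 1
  simpa using h

open Finset in
/-- Exponential moment of a sum over a uniformly random subset, sampled without replacement. -/
lemma sum_strictMono_exp_le {N m : ℕ} [NeZero N] (hm : m ≤ N) {a : Fin N → ℝ} {B l : ℝ}
    (ha : ∀ i, 0 ≤ a i) (haB : ∀ i, a i ≤ B) (hsum : ∑ i, a i = N) (hl : |l| * B ≤ 1) :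
    ∑ σ : {σ : Fin m → Fin N // StrictMono σ}, Real.exp (l * ∑ j, a (σ.1 j)) ≤
      Real.exp (m * (l + l ^ 2 * B)) * Fintype.card {σ : Fin m → Fin N // StrictMono σ} := by
  have hN : (0 : ℝ) < N := by exact_mod_cast Nat.pos_of_neZero N
  have hexp : ∀ i, Real.exp (l * a i) ≤ 1 + l * a i + l ^ 2 * B * a i := by
    intro i
    have habs : |l * a i| ≤ 1 := by
      rw [abs_mul, abs_of_nonneg (ha i)]
      exact (mul_le_mul_of_nonneg_left (haB i) (abs_nonneg l)).trans hl
    have h := (abs_le.1 (Real.abs_exp_sub_one_sub_id_le habs)).2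
    have h2 : l ^ 2 * (a i * a i) ≤ l ^ 2 * (B * a i) := by
      have := haB i
      have := ha i
      gcongr
    nlinarith
  have hmean : (∑ i, Real.exp (l * a i)) / Fintype.card (Fin N) ≤ Real.exp (l + l ^ 2 * B) := by
    rw [Fintype.card_fin, div_le_iff₀ hN]
    calc ∑ i, Real.exp (l * a i) ≤ ∑ i, (1 + l * a i + l ^ 2 * B * a i) :=
          sum_le_sum fun i _ ↦ hexp i
      _ = ((l + l ^ 2 * B) + 1) * N := by
          rw [sum_add_distrib, sum_add_distrib, ← mul_sum, ← mul_sum, hsum]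
          simp
          ring
      _ ≤ _ := by gcongr; exact Real.add_one_le_exp _
  calc ∑ σ : {σ : Fin m → Fin N // StrictMono σ}, Real.exp (l * ∑ j, a (σ.1 j))
      = ∑ σ : {σ : Fin m → Fin N // StrictMono σ},
          ∏ i ∈ univ.image σ.1, Real.exp (l * a i) := by
        refine sum_congr rfl fun σ _ ↦ ?_
        rw [prod_image σ.2.injective.injOn, ← Real.exp_sum, mul_sum]
    _ = ∑ s ∈ powersetCard m univ, ∏ i ∈ s, Real.exp (l * a i) :=
        sum_strictMono_eq_sum_powersetCard fun s ↦ ∏ i ∈ s, Real.exp (l * a i)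
    _ ≤ _ := sum_powersetCard_prod_le (fun i ↦ (Real.exp_pos _).le) (by simpa using hm)
    _ ≤ (Fintype.card (Fin N)).choose m * Real.exp (l + l ^ 2 * B) ^ m := by
        gcongr
    _ = _ := by rw [← Real.exp_nat_mul, card_strictMono_fin, Fintype.card_fin]; ring

open Finset in
/-- Two-sided Bernstein-type bound for sampling without replacement. -/
lemma uniformCount_strictMono_le {N m : ℕ} [NeZero N] (hm : m ≤ N) {a : Fin N → ℝ} {B ε : ℝ}
    (hB : 0 < B) (hε : 0 < ε) (hε2 : ε ≤ 2)
    (ha : ∀ i, 0 ≤ a i) (haB : ∀ i, a i ≤ B) (hsum : ∑ i, a i = N) :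
    uniformCount {σ : Fin m → Fin N // StrictMono σ}
      {σ | ¬(m * (1 - ε) ≤ ∑ j, a (σ.1 j) ∧ ∑ j, a (σ.1 j) ≤ m * (1 + ε))} ≤
      ENNReal.ofReal (2 * Real.exp (-(m * ε ^ 2 / (4 * B)))) := by
  have : Nonempty {σ : Fin m → Fin N // StrictMono σ} :=
    ⟨⟨Fin.castLE hm, Fin.strictMono_castLE hm⟩⟩
  set l : ℝ := ε / (2 * B) with hl_def
  have hlB : l * B = ε / 2 := by rw [hl_def]; field_simp
  have hl : 0 < l := by positivity
  have habs : |l| * B ≤ 1 := by rw [abs_of_pos hl, hlB]; linarith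
  have hup := sum_strictMono_exp_le (m := m) hm ha haB hsum habs
  have hlow := sum_strictMono_exp_le (m := m) (l := -l) hm ha haB hsum (by rwa [abs_neg])
  have hexponent : l ^ 2 * B - l * ε = -(ε ^ 2 / (4 * B)) := by
    rw [hl_def]; field_simp; ring
  refine uniformCount_le_of_sum_le
    (f := fun σ ↦ Real.exp (-(l * (m * (1 + ε)))) * Real.exp (l * ∑ j, a (σ.1 j)) +
      Real.exp (l * (m * (1 - ε))) * Real.exp (-l * ∑ j, a (σ.1 j)))
    (fun σ ↦ by positivity) ?_ ?_
  · intro σ hσ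
    simp only [← Real.exp_add]
    rw [Set.mem_ofPred_eq, not_and_or, not_le, not_le] at hσ
    rcases hσ with h | h
    · have h1 : 1 ≤ Real.exp (l * (m * (1 - ε)) + -l * ∑ j, a (σ.1 j)) :=
        Real.one_le_exp (by nlinarith)
      linarith [Real.exp_pos (-(l * (m * (1 + ε))) + l * ∑ j, a (σ.1 j))]
    · have h1 : 1 ≤ Real.exp (-(l * (m * (1 + ε))) + l * ∑ j, a (σ.1 j)) :=
        Real.one_le_exp (by nlinarith)
      linarith [Real.exp_pos (l * (m * (1 - ε)) + -l * ∑ j, a (σ.1 j))]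
  · rw [sum_add_distrib, ← mul_sum, ← mul_sum]
    have e1 : Real.exp (-(l * (m * (1 + ε)))) * Real.exp (m * (l + l ^ 2 * B)) =
        Real.exp (-(m * ε ^ 2 / (4 * B))) := by
      rw [← Real.exp_add]
      congr 1
      linear_combination (m : ℝ) * hexponent
    have e2 : Real.exp (l * (m * (1 - ε))) * Real.exp (m * (-l + (-l) ^ 2 * B)) =
        Real.exp (-(m * ε ^ 2 / (4 * B))) := by
      rw [← Real.exp_add]
      congr 1
      linear_combination (m : ℝ) * hexponent
    refine (add_le_add (mul_le_mul_of_nonneg_left hup (Real.exp_pos _).le)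
      (mul_le_mul_of_nonneg_left hlow (Real.exp_pos _).le)).trans_eq ?_
    linear_combination (e1 + e2) * (Fintype.card {σ : Fin m → Fin N // StrictMono σ} : ℝ)

lemma signOf_sq (b : Bool) : signOf b ^ 2 = 1 := by
  cases b <;> simp [signOf]

open Finset in
lemma sum_exp_rademacher_le {ι : Type*} [Fintype ι] [DecidableEq ι] (a : ι → ℝ) (t : ℝ) :
    ∑ b : ι → Bool, Real.exp (t * ∑ k, a k * signOf (b k)) ≤
      Real.exp (t ^ 2 * (∑ k, a k ^ 2) / 2) * Fintype.card (ι → Bool) := by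
  have hfactor : ∀ k, ∑ s : Bool, Real.exp (t * (a k * signOf s)) ≤
      2 * Real.exp (t ^ 2 * a k ^ 2 / 2) := by
    intro k
    have h := Real.cosh_le_exp_half_sq (t * a k)
    rw [Real.cosh_eq, mul_pow] at h
    simp only [Fintype.sum_bool, signOf, if_true, Bool.false_eq_true, if_false, mul_one, mul_neg]
    linarith
  calc ∑ b : ι → Bool, Real.exp (t * ∑ k, a k * signOf (b k))
      = ∑ b : ι → Bool, ∏ k, Real.exp (t * (a k * signOf (b k))) := by
        simp_rw [mul_sum, Real.exp_sum]
    _ = ∏ k, ∑ s : Bool, Real.exp (t * (a k * signOf s)) := by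
        rw [prod_univ_sum, Fintype.piFinset_univ]
    _ ≤ ∏ k, (2 * Real.exp (t ^ 2 * a k ^ 2 / 2)) :=
        prod_le_prod (fun k _ ↦ by positivity) fun k _ ↦ hfactor k
    _ = _ := by
        rw [prod_mul_distrib, ← Real.exp_sum, ← sum_div, ← mul_sum]
        simp
        ring

open Finset in
/-- Simultaneous tail bound for finitely many normalized Rademacher sums. -/
lemma uniformCount_rademacher_le {ι κ : Type*} [Fintype ι] [Fintype κ] [DecidableEq ι]
    {a : κ → ι → ℝ} (ha : ∀ i, ∑ k, a i k ^ 2 = 1) {R : ℝ} (hR : 0 ≤ R) :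
    uniformCount (ι → Bool) {b | ¬∀ i, |∑ k, a i k * signOf (b k)| ≤ R} ≤
      ENNReal.ofReal (2 * Fintype.card κ * Real.exp (-(R ^ 2 / 2))) := by
  set Z : κ → (ι → Bool) → ℝ := fun i b ↦ ∑ k, a i k * signOf (b k) with hZ
  have hmgf : ∀ i (t : ℝ), ∑ b, Real.exp (t * Z i b) ≤
      Real.exp (t ^ 2 / 2) * Fintype.card (ι → Bool) := by
    intro i t
    simpa [ha i] using sum_exp_rademacher_le (a i) t
  refine uniformCount_le_of_sum_le
    (f := fun b ↦ ∑ i, Real.exp (-R ^ 2) * (Real.exp (R * Z i b) + Real.exp (-R * Z i b)))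
    (fun b ↦ sum_nonneg fun i _ ↦ by positivity) ?_ ?_
  · intro b hb
    rw [Set.mem_ofPred_eq, not_forall] at hb
    obtain ⟨i, hi⟩ := hb
    rw [not_le, lt_abs] at hi
    change R < Z i b ∨ R < -Z i b at hi
    refine le_trans ?_ (single_le_sum (f := fun i ↦ Real.exp (-R ^ 2) *
      (Real.exp (R * Z i b) + Real.exp (-R * Z i b))) (fun j _ ↦ by positivity) (mem_univ i))
    simp only [mul_add, ← Real.exp_add]
    rcases hi with h | h
    · have h1 : 1 ≤ Real.exp (-R ^ 2 + R * Z i b) := Real.one_le_exp (by nlinarith)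
      linarith [Real.exp_pos (-R ^ 2 + -R * Z i b)]
    · have h1 : 1 ≤ Real.exp (-R ^ 2 + -R * Z i b) := Real.one_le_exp (by nlinarith)
      linarith [Real.exp_pos (-R ^ 2 + R * Z i b)]
  · rw [sum_comm]
    have hterm : ∀ i, ∑ b, Real.exp (-R ^ 2) * (Real.exp (R * Z i b) + Real.exp (-R * Z i b)) ≤
        2 * Real.exp (-(R ^ 2 / 2)) * Fintype.card (ι → Bool) := by
      intro i
      rw [← mul_sum, sum_add_distrib]
      have h1 := hmgf i R
      have h2 := hmgf i (-R)
      rw [neg_sq] at h2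
      have e : Real.exp (-R ^ 2) * Real.exp (R ^ 2 / 2) = Real.exp (-(R ^ 2 / 2)) := by
        rw [← Real.exp_add]
        congr 1
        ring
      refine (mul_le_mul_of_nonneg_left (add_le_add h1 h2) (Real.exp_pos _).le).trans_eq ?_
      linear_combination 2 * e * (Fintype.card (ι → Bool) : ℝ)
    refine (sum_le_sum fun i _ ↦ hterm i).trans_eq ?_
    rw [sum_const, card_univ, nsmul_eq_mul]
    ring

open Finset in
lemma hadamardEntry_eq_prod (n : ℕ) (i j : Fin (2 ^ n)) :
    hadamardEntry n i j =
      ∏ k ∈ range n, if (i : ℕ).testBit k && (j : ℕ).testBit k then (-1 : ℝ) else 1 := by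
  rw [hadamardEntry, ← prod_pow_eq_pow_sum]
  refine prod_congr rfl fun k _ ↦ ?_
  simp only [Nat.shiftRight_eq_div_pow, ← Nat.toNat_testBit]
  cases (i : ℕ).testBit k <;> cases (j : ℕ).testBit k <;> simp

lemma hadamardEntry_sq (n : ℕ) (i j : Fin (2 ^ n)) : hadamardEntry n i j ^ 2 = 1 := by
  rw [hadamardEntry, ← pow_mul, mul_comm, pow_mul]
  simp

open Finset in
lemma sum_hadamardEntry_mul_of_ne {n : ℕ} {j k : Fin (2 ^ n)} (hjk : j ≠ k) :
    ∑ i, hadamardEntry n i j * hadamardEntry n i k = 0 := by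
  obtain ⟨t, ht⟩ : ∃ t, (j : ℕ).testBit t ≠ (k : ℕ).testBit t := by
    by_contra! h
    exact hjk (Fin.ext (Nat.eq_of_testBit_eq h))
  have htn : t < n := by
    by_contra! h
    have hlt : ∀ l : Fin (2 ^ n), (l : ℕ).testBit t = false := fun l ↦
      Nat.testBit_lt_two_pow (l.2.trans_le (Nat.pow_le_pow_right two_pos h))
    exact ht (by rw [hlt, hlt])
  let g : Fin (2 ^ n) → Fin (2 ^ n) := fun i ↦
    ⟨(i : ℕ) ^^^ 2 ^ t, Nat.xor_lt_two_pow i.2 (Nat.pow_lt_pow_right one_lt_two htn)⟩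
  have hflip : ∀ i l : Fin (2 ^ n), hadamardEntry n (g i) l =
      (if (l : ℕ).testBit t then -1 else 1) * hadamardEntry n i l := by
    intro i l
    rw [hadamardEntry_eq_prod, hadamardEntry_eq_prod, ← mul_prod_erase _ _ (mem_range.2 htn),
      ← mul_prod_erase (range n) _ (mem_range.2 htn), ← mul_assoc]
    congr 1
    · simp only [g, Nat.testBit_xor, Nat.testBit_two_pow]
      cases (i : ℕ).testBit t <;> cases (l : ℕ).testBit t <;> simp
    · refine prod_congr rfl fun s hs ↦ ?_
      have hst : ¬t = s := fun h ↦ (mem_erase.1 hs).1 h.symm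
      simp [g, Nat.testBit_xor, hst]
  have hneg : ∀ i, hadamardEntry n (g i) j * hadamardEntry n (g i) k =
      -(hadamardEntry n i j * hadamardEntry n i k) := by
    intro i
    rw [hflip, hflip]
    revert ht
    cases (j : ℕ).testBit t <;> cases (k : ℕ).testBit t <;> simp
  have hg : Function.Involutive g := fun i ↦ Fin.ext (by simp [g])
  have h := Equiv.sum_comp hg.toPerm fun i ↦ hadamardEntry n i j * hadamardEntry n i k
  simp only [Function.Involutive.coe_toPerm, hneg, sum_neg_distrib] at h
  linarith

open Finset in
/-- Parseval's identity for the Hadamard matrix. -/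
lemma sum_sq_hadamard (n : ℕ) (c : Fin (2 ^ n) → ℝ) :
    ∑ i, (∑ k, hadamardEntry n i k * c k) ^ 2 = (2 ^ n : ℕ) * ∑ k, c k ^ 2 := by
  calc ∑ i, (∑ k, hadamardEntry n i k * c k) ^ 2
      = ∑ i, ∑ j, ∑ k, hadamardEntry n i j * hadamardEntry n i k * (c j * c k) := by
        refine sum_congr rfl fun i _ ↦ ?_
        rw [sq, sum_mul_sum]
        exact sum_congr rfl fun j _ ↦ sum_congr rfl fun k _ ↦ by ring
    _ = ∑ j, ∑ k, (∑ i, hadamardEntry n i j * hadamardEntry n i k) * (c j * c k) := by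
        rw [sum_comm]
        refine sum_congr rfl fun j _ ↦ ?_
        rw [sum_comm]
        simp_rw [sum_mul]
    _ = ∑ j, (2 ^ n : ℕ) * c j ^ 2 := by
        refine sum_congr rfl fun j _ ↦ ?_
        rw [sum_eq_single j (fun k _ hk ↦ by rw [sum_hadamardEntry_mul_of_ne hk.symm, zero_mul])
          (by simp)]
        simp_rw [← sq, hadamardEntry_sq]
        simp
    _ = _ := by rw [mul_sum]

open Finset in
lemma sum_sq_fastEmbed (n m : ℕ) (σ : Fin m → Fin (2 ^ n)) (b : Fin (2 ^ n) → Bool)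
    (u : Fin (2 ^ n) → ℝ) :
    ∑ j, fastEmbed n m σ b u j ^ 2 =
      (m : ℝ)⁻¹ * ∑ j, (∑ k, hadamardEntry n (σ j) k * u k * signOf (b k)) ^ 2 := by
  rw [mul_sum]
  refine sum_congr rfl fun j _ ↦ ?_
  rw [fastEmbed, mul_pow, inv_pow, Real.sq_sqrt (Nat.cast_nonneg m)]
  simp_rw [mul_right_comm _ (signOf _)]

open Finset in
lemma jlMeasure_sum_sq_fastEmbed_le {n m : ℕ} (hm0 : 0 < m) (hm : m ≤ 2 ^ n)
    {u : Fin (2 ^ n) → ℝ} (hu : ∑ k, u k ^ 2 = 1) {R ε : ℝ} (hR : 0 < R) (hε : 0 < ε)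
    (hε2 : ε ≤ 2) :
    jlMeasure n m {ω | ¬(1 - ε ≤ ∑ j, fastEmbed n m ω.1.1 ω.2 u j ^ 2 ∧
        ∑ j, fastEmbed n m ω.1.1 ω.2 u j ^ 2 ≤ 1 + ε)} ≤
      ENNReal.ofReal (2 * (2 ^ n : ℕ) * Real.exp (-(R ^ 2 / 2)) +
        2 * Real.exp (-(m * ε ^ 2 / (4 * R ^ 2)))) := by
  have : Nonempty {σ : Fin m → Fin (2 ^ n) // StrictMono σ} :=
    ⟨⟨Fin.castLE hm, Fin.strictMono_castLE hm⟩⟩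
  have hm0' : (0 : ℝ) < m := by exact_mod_cast hm0
  have hrow : ∀ i, ∑ k, (hadamardEntry n i k * u k) ^ 2 = 1 := by
    intro i
    simp_rw [mul_pow, hadamardEntry_sq, one_mul, hu]
  rw [ENNReal.ofReal_add (by positivity) (by positivity), jlMeasure]
  have hflat := uniformCount_rademacher_le hrow hR.le
  rw [Fintype.card_fin] at hflat
  refine prod_measure_le_add hflat fun b hb ↦ ?_
  rw [Set.mem_ofPred_eq, not_not] at hb
  have hparseval : ∑ i, (∑ k, hadamardEntry n i k * u k * signOf (b k)) ^ 2 = (2 ^ n : ℕ) := by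
    have h := sum_sq_hadamard n fun k ↦ u k * signOf (b k)
    simp_rw [mul_pow, signOf_sq, mul_one, hu, mul_one, ← mul_assoc] at h
    exact h
  refine le_trans (measure_mono ?_) (uniformCount_strictMono_le hm (pow_pos hR 2) hε hε2
    (fun i ↦ sq_nonneg _) (fun i ↦ sq_le_sq' (abs_le.1 (hb i)).1 (abs_le.1 (hb i)).2) hparseval)
  intro σ hσ
  rw [Set.mem_ofPred_eq] at hσ ⊢
  refine mt (fun h ↦ ?_) hσ
  rw [sum_sq_fastEmbed, inv_mul_eq_div, le_div_iff₀ hm0', div_le_iff₀ hm0', mul_comm (1 - ε),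
    mul_comm (1 + ε)]
  exact h

/-- Homogeneous form of `jlMeasure_sum_sq_fastEmbed_le`. -/
lemma jlMeasure_distortion_le {n m : ℕ} (hm0 : 0 < m) (hm : m ≤ 2 ^ n)
    (v : Fin (2 ^ n) → ℝ) {R ε : ℝ} (hR : 0 < R) (hε : 0 < ε) (hε2 : ε ≤ 2) :
    jlMeasure n m {ω | ¬((1 - ε) * ∑ k, v k ^ 2 ≤ ∑ j, fastEmbed n m ω.1.1 ω.2 v j ^ 2 ∧
        ∑ j, fastEmbed n m ω.1.1 ω.2 v j ^ 2 ≤ (1 + ε) * ∑ k, v k ^ 2)} ≤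
      ENNReal.ofReal (2 * (2 ^ n : ℕ) * Real.exp (-(R ^ 2 / 2)) +
        2 * Real.exp (-(m * ε ^ 2 / (4 * R ^ 2)))) := by
  obtain ⟨N, hN⟩ : ∃ N, N = ∑ k, v k ^ 2 := ⟨_, rfl⟩
  rw [← hN]
  rcases (hN ▸ Finset.sum_nonneg fun k _ ↦ sq_nonneg (v k) : 0 ≤ N).eq_or_lt with h0 | hpos
  · have hv : ∀ k, v k = 0 := by
      intro k
      have h := (Finset.sum_eq_zero_iff_of_nonneg fun k _ ↦ sq_nonneg (v k)).1 (h0.trans hN).symm k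
        (Finset.mem_univ k)
      exact pow_eq_zero_iff two_ne_zero |>.1 h
    simp [← h0, fastEmbed, hv]
  · have hu : ∑ k, (v k / √N) ^ 2 = 1 := by
      simp only [div_pow, Real.sq_sqrt hpos.le]
      rw [← Finset.sum_div, ← hN, div_self hpos.ne']
    refine le_trans (measure_mono fun ω hω ↦ ?_)
      (jlMeasure_sum_sq_fastEmbed_le hm0 hm hu hR hε hε2)
    rw [Set.mem_ofPred_eq] at hω ⊢
    refine mt (fun h ↦ ?_) hω
    have hscale : ∑ j, fastEmbed n m ω.1.1 ω.2 (fun k ↦ v k / √N) j ^ 2 =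
        (∑ j, fastEmbed n m ω.1.1 ω.2 v j ^ 2) / N := by
      simp only [fastEmbed, mul_div_assoc', ← Finset.sum_div, div_pow, Real.sq_sqrt hpos.le]
    rwa [hscale, le_div_iff₀ hpos, div_le_iff₀ hpos] at h

/-- Johnson–Lindenstrauss property of the subsampled randomized Hadamard transform
(Lemma 3.4): for `γ ≥ 1`, `d = 2^n ≥ 16`, unit vectors `x, y ∈ S^{d−1}`, and
`m = ⌈C(γ)(ln d)⁴(ln ln d)⁴⌉ ≤ d`, with probability at least `1 − C'(γ)d^{−γ}` the map
`x ↦ (1/√m) H_S D_b x` preserves the squared norms of `x`, `y` and `x − y` up to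
factor `1 ± 1/ln d`. -/
theorem stmt_4 (γ : ℝ) (hγ : 1 ≤ γ) :
    ∃ C : ℝ, 0 < C ∧ ∃ C' : ℝ, 0 < C' ∧
      ∀ n : ℕ, 16 ≤ 2 ^ n →
        ∀ x y : EuclideanSpace ℝ (Fin (2 ^ n)), ‖x‖ = 1 → ‖y‖ = 1 →
          ∀ m : ℕ,
            m = ⌈C * (Real.log (2 ^ n : ℕ)) ^ 4 *
                  (Real.log (Real.log (2 ^ n : ℕ))) ^ 4⌉₊ →
            m ≤ 2 ^ n →
            1 - C' * ((2 ^ n : ℕ) : ℝ) ^ (-γ) ≤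
              ((jlMeasure n m)
                {ω | (1 - 1 / Real.log (2 ^ n : ℕ) ≤
                          ∑ j, (fastEmbed n m ω.1.1 ω.2 (fun i => x i) j) ^ 2 ∧
                        ∑ j, (fastEmbed n m ω.1.1 ω.2 (fun i => x i) j) ^ 2 ≤
                          1 + 1 / Real.log (2 ^ n : ℕ)) ∧
                     (1 - 1 / Real.log (2 ^ n : ℕ) ≤
                          ∑ j, (fastEmbed n m ω.1.1 ω.2 (fun i => y i) j) ^ 2 ∧
                        ∑ j, (fastEmbed n m ω.1.1 ω.2 (fun i => y i) j) ^ 2 ≤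
                          1 + 1 / Real.log (2 ^ n : ℕ)) ∧
                     ((1 - 1 / Real.log (2 ^ n : ℕ)) * ‖x - y‖ ^ 2 ≤
                          ∑ j, (fastEmbed n m ω.1.1 ω.2 (fun i => x i - y i) j) ^ 2 ∧
                        ∑ j, (fastEmbed n m ω.1.1 ω.2 (fun i => x i - y i) j) ^ 2 ≤
                          (1 + 1 / Real.log (2 ^ n : ℕ)) * ‖x - y‖ ^ 2)}).toReal := by
  refine ⟨8 * γ * (γ + 1), by positivity, 12, by norm_num, ?_⟩
  intro n hn x y hx hy m hm hmd
  have hn' : (16 : ℝ) ≤ ((2 ^ n : ℕ) : ℝ) := by exact_mod_cast hn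
  have hd : (0 : ℝ) < ((2 ^ n : ℕ) : ℝ) := by linarith
  set L := Real.log (2 ^ n : ℕ) with hL_def
  have hL : Real.exp 1 ≤ L := by
    have h16 : Real.log 16 = 4 * Real.log 2 := by
      rw [show (16 : ℝ) = 2 ^ 4 by norm_num, Real.log_pow]
      norm_num
    have hmono : Real.log 16 ≤ L := Real.log_le_log (by norm_num) hn'
    linarith [Real.exp_one_lt_d9, Real.log_two_gt_d9]
  have hL1 : 1 ≤ L := (Real.one_le_exp zero_le_one).trans hL
  have hL0 : 0 < L := zero_lt_one.trans_le hL1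
  have hlogL : 1 ≤ Real.log L := (Real.le_log_iff_exp_le hL0).2 hL
  have hmL : 8 * γ * (γ + 1) * L ^ 4 ≤ m := by
    rw [hm]
    refine le_trans ?_ (Nat.le_ceil _)
    exact le_mul_of_one_le_right (by positivity) (one_le_pow₀ hlogL)
  have hm0 : 0 < m := by
    have : (0 : ℝ) < m := lt_of_lt_of_le (by positivity) hmL
    exact_mod_cast this
  have : Nonempty {σ : Fin m → Fin (2 ^ n) // StrictMono σ} :=
    ⟨⟨Fin.castLE hmd, Fin.strictMono_castLE hmd⟩⟩
  have : IsProbabilityMeasure (jlMeasure n m) := by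
    rw [jlMeasure]
    infer_instance
  have hbound : ∀ v : Fin (2 ^ n) → ℝ,
      (jlMeasure n m).real {ω | ¬((1 - 1 / L) * ∑ k, v k ^ 2 ≤
          ∑ j, fastEmbed n m ω.1.1 ω.2 v j ^ 2 ∧
        ∑ j, fastEmbed n m ω.1.1 ω.2 v j ^ 2 ≤ (1 + 1 / L) * ∑ k, v k ^ 2)} ≤
      4 * ((2 ^ n : ℕ) : ℝ) ^ (-γ) := by
    intro v
    have hR : 0 < 2 * (γ + 1) * L := by positivity
    refine ENNReal.toReal_le_of_le_ofReal (by positivity)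
      ((jlMeasure_distortion_le hm0 hmd v (Real.sqrt_pos.2 hR) (one_div_pos.2 hL0)
        (((div_le_one hL0).2 hL1).trans one_le_two)).trans (ENNReal.ofReal_le_ofReal ?_))
    rw [Real.sq_sqrt hR.le]
    have hflat : ((2 ^ n : ℕ) : ℝ) * Real.exp (-(2 * (γ + 1) * L / 2)) =
        ((2 ^ n : ℕ) : ℝ) ^ (-γ) := by
      rw [Real.rpow_def_of_pos hd, ← hL_def]
      nth_rw 1 [← Real.exp_log hd]
      rw [← Real.exp_add, ← hL_def]
      congr 1
      ring
    have hsample : Real.exp (-(m * (1 / L) ^ 2 / (4 * (2 * (γ + 1) * L)))) ≤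
        ((2 ^ n : ℕ) : ℝ) ^ (-γ) := by
      rw [Real.rpow_def_of_pos hd, ← hL_def, Real.exp_le_exp, mul_neg, neg_le_neg_iff,
        le_div_iff₀ (by positivity), one_div, inv_pow, ← div_eq_mul_inv, le_div_iff₀ (by positivity)]
      linarith
    linarith
  have hnorm : ∀ z : EuclideanSpace ℝ (Fin (2 ^ n)), ‖z‖ ^ 2 = ∑ k, z k ^ 2 :=
    EuclideanSpace.real_norm_sq_eq
  have hbx := hbound fun k ↦ x k
  have hby := hbound fun k ↦ y k
  have hbxy := hbound fun k ↦ x k - y k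
  have hx2 : ∑ k, x k ^ 2 = 1 := by rw [← hnorm, hx, one_pow]
  have hy2 : ∑ k, y k ^ 2 = 1 := by rw [← hnorm, hy, one_pow]
  have hxy2 : ‖x - y‖ ^ 2 = ∑ k, (x k - y k) ^ 2 := hnorm (x - y)
  simp only [hx2, hy2, mul_one] at hbx hby
  rw [hxy2, ← Measure.real]
  have hunion := (measureReal_union_le (μ := jlMeasure n m) _ _).trans
    (add_le_add ((measureReal_union_le _ _).trans (add_le_add hbx hby)) hbxy)
  rw [sub_le_comm, ← probReal_compl_eq_one_sub MeasurableSet.of_discrete]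
  refine (measureReal_mono fun ω hω ↦ ?_).trans (hunion.trans_eq (by ring))
  simp only [Set.mem_compl_iff, Set.mem_ofPred_eq, Set.mem_union] at hω ⊢
  tauto
end

section
/- Let 0 < ε ≤ 1/2, let x, y ∈ ℝ^d be unit vectors, and let x̃, ỹ ∈ ℝ^m be nonzero vectors satisfying (1 − ε) ≤ ‖x̃‖₂² ≤ (1 + ε), (1 − ε) ≤ ‖ỹ‖₂² ≤ (1 + ε), and (1 − ε)‖x − y‖₂² ≤ ‖x̃ − ỹ‖₂² ≤ (1 + ε)‖x − y‖₂². Then | ‖x̃/‖x̃‖₂ − ỹ/‖ỹ‖₂‖₂² − ‖x − y‖₂² | ≤ 16ε. In particular, the distance between the normalized images of x and y differs from the distance between x and y by O(ε). -/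
/-- The squared distance between two normalized vectors, scaled by the product of the norms. -/
theorem norm_sub_sq_normalized_mul {E : Type*} [NormedAddCommGroup E] [InnerProductSpace ℝ E]
    {u v : E} (hu : u ≠ 0) (hv : v ≠ 0) :
    ‖‖u‖⁻¹ • u - ‖v‖⁻¹ • v‖ ^ 2 * (‖u‖ * ‖v‖) = ‖u - v‖ ^ 2 - (‖u‖ - ‖v‖) ^ 2 := by
  have hu' : ‖u‖ ≠ 0 := norm_ne_zero_iff.mpr hu
  have hv' : ‖v‖ ≠ 0 := norm_ne_zero_iff.mpr hv
  rw [norm_sub_sq_real, norm_sub_sq_real, real_inner_smul_left, real_inner_smul_right,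
    norm_smul, norm_smul, norm_inv, norm_inv, norm_norm, norm_norm]
  field_simp
  ring

/-- If `x, y` are unit vectors, and `x̃, ỹ` are nonzero vectors whose squared norms are
within `ε` of `1` and with `‖x̃ − ỹ‖²` within relative error `ε` of `‖x − y‖²`
(`0 < ε ≤ 1/2`), then the squared distance between the normalizations `x̃/‖x̃‖` and `ỹ/‖ỹ‖`
differs from `‖x − y‖²` by at most `16ε`. -/
theorem stmt_5 {d m : ℕ} (ε : ℝ) (hε : 0 < ε) (hε' : ε ≤ 1 / 2)
    (x y : EuclideanSpace ℝ (Fin d)) (hx : ‖x‖ = 1) (hy : ‖y‖ = 1)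
    (xt yt : EuclideanSpace ℝ (Fin m)) (hxt : xt ≠ 0) (hyt : yt ≠ 0)
    (h1l : 1 - ε ≤ ‖xt‖ ^ 2) (h1u : ‖xt‖ ^ 2 ≤ 1 + ε)
    (h2l : 1 - ε ≤ ‖yt‖ ^ 2) (h2u : ‖yt‖ ^ 2 ≤ 1 + ε)
    (h3l : (1 - ε) * ‖x - y‖ ^ 2 ≤ ‖xt - yt‖ ^ 2)
    (h3u : ‖xt - yt‖ ^ 2 ≤ (1 + ε) * ‖x - y‖ ^ 2) :
    |‖‖xt‖⁻¹ • xt - ‖yt‖⁻¹ • yt‖ ^ 2 - ‖x - y‖ ^ 2| ≤ 16 * ε := by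
  have ha : 0 < ‖xt‖ := norm_pos_iff.mpr hxt
  have hb : 0 < ‖yt‖ := norm_pos_iff.mpr hyt
  have hN := norm_sub_sq_normalized_mul hxt hyt
  have hN0 : 0 ≤ ‖‖xt‖⁻¹ • xt - ‖yt‖⁻¹ • yt‖ ^ 2 := sq_nonneg _
  have hD0 : 0 ≤ ‖x - y‖ ^ 2 := sq_nonneg _
  have hD4 : ‖x - y‖ ^ 2 ≤ 4 := by
    have h := norm_sub_le x y
    rw [hx, hy] at h
    nlinarith [norm_nonneg (x - y)]
  generalize ‖‖xt‖⁻¹ • xt - ‖yt‖⁻¹ • yt‖ ^ 2 = N at *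
  generalize ‖x - y‖ ^ 2 = D at *
  generalize ‖xt - yt‖ ^ 2 = T at *
  generalize ‖xt‖ = a at *
  generalize ‖yt‖ = b at *
  have hab_l : 1 - ε ≤ a * b := by
    refine (sq_le_sq₀ (by linarith) (by positivity)).mp ?_
    nlinarith [mul_le_mul h1l h2l (by linarith) (by positivity)]
  have hab_u : a * b ≤ 1 + ε := by nlinarith [sq_nonneg (a - b)]
  have hdiff : (a - b) ^ 2 ≤ 2 * ε := by
    rcases le_total a b with h | h
    · nlinarith [mul_nonneg ha.le (sub_nonneg.mpr h)]
    · nlinarith [mul_nonneg hb.le (sub_nonneg.mpr h)]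
  have hNl : N * (1 - ε) ≤ N * (a * b) := mul_le_mul_of_nonneg_left hab_l hN0
  have hNu : N * (a * b) ≤ N * (1 + ε) := mul_le_mul_of_nonneg_left hab_u hN0
  have hεD : ε * D ≤ ε * 4 := mul_le_mul_of_nonneg_left hD4 hε.le
  rw [abs_le]
  constructor
  · by_contra! h
    nlinarith [mul_pos hε (sub_pos.mpr h)]
  · have h : (N - D) * (1 - ε) ≤ 8 * ε := by nlinarith [sq_nonneg (a - b)]
    by_contra! h'
    nlinarith [mul_le_mul_of_nonneg_right h'.le (by linarith : 0 ≤ 1 - ε)]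
end

section
/- For every R̃ ∈ (0,2) and every C₁ > 0 there exist a constant C₂ = C₂(R̃, C₁) > 0 and a threshold d₀ = d₀(R̃, C₁) such that the following holds for all d ≥ d₀. Let m and d' be integers with m ≤ C₁ (ln d)^4 and m ≤ d' ≤ d, and let x̃, ỹ ∈ ℝ^m be unit vectors with ‖x̃ − ỹ‖₂ = R̃. Let G' ∈ ℝ^{d'×m} have i.i.d. N(0,1) entries, and let Ĝ ∈ ℝ^{d'×m} have i.i.d. entries distributed as a real random variable X whose CDF F_X satisfies sup_{t∈ℝ} |F_X(t) − Φ(t)| ≤ d^{−ln d}. Then | ln Pr[h_{Ĝ}(x̃) = h_{Ĝ}(ỹ)] − ln Pr[h_{G'}(x̃) = h_{G'}(ỹ)] | ≤ C₂. -/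
open MeasureTheory ProbabilityTheory

/-- The law of a `k × m` matrix with i.i.d. standard Gaussian entries. -/
noncomputable def gaussMatrix (k m : ℕ) : Measure (Fin k → Fin m → ℝ) :=
  Measure.pi fun _ => Measure.pi fun _ => gaussianReal 0 1

/-- `(Av)_i` for a matrix `A` given by rows and a vector `v`. -/
def mvMul {k m : ℕ} (A : Fin k → Fin m → ℝ) (v : Fin m → ℝ) (i : Fin k) : ℝ :=
  ∑ j, A i j * v j

/-- The event that `v` cross-polytope hashes to `s·e_i` under `A`, via strict inequalities. -/
def hashAt {k m : ℕ} (A : Fin k → Fin m → ℝ) (v : Fin m → ℝ) (i : Fin k) (s : ℝ) : Prop :=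
  ∀ j, j ≠ i → |mvMul A v j| < s * mvMul A v i

/-- The event that `v` and `w` receive the same cross-polytope hash under `A`. -/
def collide {k m : ℕ} (A : Fin k → Fin m → ℝ) (v w : Fin m → ℝ) : Prop :=
  ∃ (i : Fin k) (s : ℝ), (s = 1 ∨ s = -1) ∧ hashAt A v i s ∧ hashAt A w i s

/-- The standard Gaussian cumulative distribution function. -/
noncomputable def Phi (x : ℝ) : ℝ := ((gaussianReal 0 1) (Set.Iic x)).toReal

open Set Filter Topology

/-- A lower bound for the standard Gaussian measure of an interval contained in `[-M, M]`. -/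
lemma gaussianReal_real_Ioc_ge {a b M : ℝ} (hab : a ≤ b) (ha : -M ≤ a) (hb : b ≤ M) :
    (b - a) * (Real.exp (-M ^ 2 / 2) / 3) ≤ (gaussianReal 0 1).real (Ioc a b) := by
  rw [measureReal_def, gaussianReal_apply_eq_integral _ one_ne_zero,
    ENNReal.toReal_ofReal (integral_nonneg fun x => gaussianPDFReal_nonneg _ _ _)]
  have h3 : √(2 * Real.pi) ≤ 3 := by
    rw [Real.sqrt_le_left (by norm_num)]
    nlinarith [Real.pi_lt_four]
  have hconst : ∫ _ in Ioc a b, Real.exp (-M ^ 2 / 2) / 3 =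
      (b - a) * (Real.exp (-M ^ 2 / 2) / 3) := by
    rw [setIntegral_const, Real.volume_real_Ioc_of_le hab, smul_eq_mul]
  rw [← hconst]
  refine setIntegral_mono_on (integrable_const _)
    (integrable_gaussianPDFReal _ _).integrableOn measurableSet_Ioc fun x hx => ?_
  rw [gaussianPDFReal, div_eq_inv_mul]
  have hx2 : x ^ 2 ≤ M ^ 2 := sq_le_sq' (by linarith [hx.1]) (by linarith [hx.2])
  have hexp : Real.exp (-M ^ 2 / 2) ≤ Real.exp (-(x - 0) ^ 2 / (2 * (1 : NNReal))) := by
    apply Real.exp_le_exp.2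
    simp only [NNReal.coe_one]
    linarith
  have hinv : (3 : ℝ)⁻¹ ≤ (√(2 * Real.pi * (1 : NNReal)))⁻¹ := by
    simp only [NNReal.coe_one, mul_one]
    exact inv_anti₀ (Real.sqrt_pos.2 (by positivity)) h3
  gcongr

/-- Anti-concentration of a centred Gaussian of variance at least one. -/
lemma gaussianReal_real_Icc_le {v : NNReal} (hv : 1 ≤ v) {a b : ℝ} (hab : a ≤ b) :
    (gaussianReal 0 v).real (Icc a b) ≤ b - a := by
  have hv0 : v ≠ 0 := (zero_lt_one.trans_le hv).ne'
  have hv' : (1 : ℝ) ≤ v := by exact_mod_cast hv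
  rw [measureReal_def, gaussianReal_apply_eq_integral _ hv0,
    ENNReal.toReal_ofReal (integral_nonneg fun x => gaussianPDFReal_nonneg _ _ _)]
  have hconst : ∫ _ in Icc a b, (1 : ℝ) = b - a := by
    rw [setIntegral_const, Real.volume_real_Icc_of_le hab, smul_eq_mul, mul_one]
  rw [← hconst]
  refine setIntegral_mono_on (integrable_gaussianPDFReal _ _).integrableOn
    (integrable_const _) measurableSet_Icc fun x _ => ?_
  rw [gaussianPDFReal]
  have h1 : (1 : ℝ) ≤ √(2 * Real.pi * v) := by
    rw [Real.one_le_sqrt]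
    nlinarith [Real.pi_gt_three]
  have h2 : Real.exp (-(x - 0) ^ 2 / (2 * v)) ≤ 1 := by
    rw [Real.exp_le_one_iff]
    exact div_nonpos_of_nonpos_of_nonneg (by nlinarith [sq_nonneg (x - 0)]) (by positivity)
  exact mul_le_one₀ (inv_le_one_of_one_le₀ h1) (Real.exp_pos _).le h2

/-- The sub-Gaussian tail of the standard normal distribution. -/
lemma gaussianReal_real_Ici_le {t : ℝ} (ht : 0 ≤ t) :
    (gaussianReal 0 1).real (Ici t) ≤ Real.exp (-t ^ 2 / 2) := by
  have h := measure_ge_le_exp_mul_mgf (μ := gaussianReal 0 1) (X := id) t ht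
    (integrable_exp_mul_gaussianReal t)
  rw [mgf_id_gaussianReal, ← Real.exp_add] at h
  refine h.trans (le_of_eq ?_)
  congr 1
  simp only [NNReal.coe_one]
  ring

lemma gaussianReal_real_abs_gt_le {t : ℝ} (ht : 0 ≤ t) :
    (gaussianReal 0 1).real {x | t < |x|} ≤ 2 * Real.exp (-t ^ 2 / 2) := by
  have hsub : {x : ℝ | t < |x|} ⊆ Ici t ∪ (fun x => -x) ⁻¹' Ici t := by
    intro x hx
    rcases lt_abs.1 (show t < |x| from hx) with h | h
    · exact Or.inl h.le
    · exact Or.inr h.le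
  have hneg : (gaussianReal 0 1).real ((fun x => -x) ⁻¹' Ici t) =
      (gaussianReal 0 1).real (Ici t) := by
    rw [← map_measureReal_apply measurable_neg measurableSet_Ici]
    congr 1
    rw [gaussianReal_map_neg, neg_zero]
  calc _ ≤ (gaussianReal 0 1).real (Ici t ∪ (fun x => -x) ⁻¹' Ici t) := measureReal_mono hsub
    _ ≤ _ := measureReal_union_le _ _
    _ ≤ _ := by rw [hneg]; linarith [gaussianReal_real_Ici_le ht]

lemma Phi_sub_Phi {a b : ℝ} (hab : a ≤ b) :
    Phi b - Phi a = (gaussianReal 0 1).real (Ioc a b) := by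
  have h : (gaussianReal 0 1).real (Iic b) =
      (gaussianReal 0 1).real (Iic a) + (gaussianReal 0 1).real (Ioc a b) := by
    rw [← Iic_union_Ioc_eq_Iic hab, measureReal_union _ measurableSet_Ioc]
    exact disjoint_left.2 fun x hx hx' => not_lt.2 (mem_Iic.1 hx) hx'.1
  change (gaussianReal 0 1).real (Iic b) - (gaussianReal 0 1).real (Iic a) = _
  linarith

lemma Phi_strictMono : StrictMono Phi := by
  intro a b hab
  have h := gaussianReal_real_Ioc_ge (M := max |a| |b|) hab.le
    (by linarith [neg_abs_le a, le_max_left |a| |b|]) (by linarith [le_abs_self b, le_max_right |a| |b|])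
  rw [← Phi_sub_Phi hab.le] at h
  have : 0 < (b - a) * (Real.exp (-(max |a| |b|) ^ 2 / 2) / 3) :=
    mul_pos (by linarith) (by positivity)
  linarith

lemma Phi_sub_Phi_le {a b : ℝ} (hab : a ≤ b) : Phi b - Phi a ≤ b - a := by
  rw [Phi_sub_Phi hab]
  exact (measureReal_mono Ioc_subset_Icc_self).trans (gaussianReal_real_Icc_le le_rfl hab)

lemma continuous_Phi : Continuous Phi := by
  refine (LipschitzWith.of_le_add fun x y => ?_).continuous
  rcases le_total x y with h | h
  · have := Phi_strictMono.monotone h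
    have := dist_nonneg (x := x) (y := y)
    linarith
  · have := Phi_sub_Phi_le h
    rw [Real.dist_eq, abs_of_nonneg (by linarith)]
    linarith

lemma Phi_eq_cdf : Phi = cdf (gaussianReal 0 1) := by
  ext x
  rw [cdf_eq_real]
  rfl

lemma Phi_pos (x : ℝ) : 0 < Phi x :=
  (cdf_nonneg (gaussianReal 0 1) (x - 1)).trans_lt
    (by rw [← Phi_eq_cdf]; exact Phi_strictMono (by linarith))

lemma Phi_lt_one (x : ℝ) : Phi x < 1 :=
  lt_of_lt_of_le (Phi_strictMono (by linarith : x < x + 1))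
    (by rw [Phi_eq_cdf]; exact cdf_le_one _ _)

lemma exists_Phi_eq {p : ℝ} (h0 : 0 < p) (h1 : p < 1) : ∃ x, Phi x = p := by
  obtain ⟨a, ha⟩ := ((tendsto_cdf_atBot (gaussianReal 0 1)).eventually (gt_mem_nhds h0)).exists
  obtain ⟨b, hb⟩ := ((tendsto_cdf_atTop (gaussianReal 0 1)).eventually (lt_mem_nhds h1)).exists
  rw [← Phi_eq_cdf] at ha hb
  exact mem_range_of_exists_le_of_exists_ge continuous_Phi ⟨a, ha.le⟩ ⟨b, hb.le⟩

lemma gaussianReal_Phi_le {p : ℝ} (h0 : 0 ≤ p) (h1 : p ≤ 1) :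
    (gaussianReal 0 1).real {g | Phi g ≤ p} = p := by
  rcases h0.eq_or_lt with rfl | h0
  · have : {g | Phi g ≤ 0} = ∅ := by
      ext g; simpa using Phi_pos g
    simp [this]
  rcases h1.eq_or_lt with rfl | h1
  · have : {g | Phi g ≤ 1} = univ := by
      ext g; simpa using (Phi_lt_one g).le
    simp [this]
  obtain ⟨x, rfl⟩ := exists_Phi_eq h0 h1
  have : {g | Phi g ≤ Phi x} = Iic x := by
    ext g; exact Phi_strictMono.le_iff_le
  rw [this]
  rfl

/-- The monotone transport from the standard Gaussian to `ν`. -/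
noncomputable def gaussTransport (ν : Measure ℝ) (g : ℝ) : ℝ := sInf {t | Phi g ≤ cdf ν t}

lemma gaussTransport_le_iff (ν : Measure ℝ) (g t : ℝ) :
    gaussTransport ν g ≤ t ↔ Phi g ≤ cdf ν t := by
  obtain ⟨b, hb⟩ := ((tendsto_cdf_atTop ν).eventually (lt_mem_nhds (Phi_lt_one g))).exists
  obtain ⟨a, ha⟩ := ((tendsto_cdf_atBot ν).eventually (gt_mem_nhds (Phi_pos g))).exists
  have hne : {t | Phi g ≤ cdf ν t}.Nonempty := ⟨b, hb.le⟩
  have hbdd : BddBelow {t | Phi g ≤ cdf ν t} :=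
    ⟨a, fun s hs => (lt_of_not_ge fun hsa =>
      absurd (hs.trans (monotone_cdf ν hsa)) (not_le.2 ha)).le⟩
  refine ⟨fun h => ?_, fun h => csInf_le hbdd h⟩
  refine ge_of_tendsto (((cdf ν).right_continuous t).mono_left (nhdsWithin_mono _ Ioi_subset_Ici_self))
    (eventually_nhdsWithin_of_forall fun s hs => ?_)
  obtain ⟨r, hr, hrs⟩ := exists_lt_of_csInf_lt hne (h.trans_lt hs)
  exact le_trans hr (monotone_cdf ν hrs.le)

lemma gaussTransport_monotone (ν : Measure ℝ) : Monotone (gaussTransport ν) := fun _ _ h =>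
  (gaussTransport_le_iff ν _ _).2
    ((Phi_strictMono.monotone h).trans ((gaussTransport_le_iff ν _ _).1 le_rfl))

lemma measurePreserving_gaussTransport (ν : Measure ℝ) [IsProbabilityMeasure ν] :
    MeasurePreserving (gaussTransport ν) (gaussianReal 0 1) ν := by
  have hm := (gaussTransport_monotone ν).measurable
  refine ⟨hm, ?_⟩
  have := Measure.isProbabilityMeasure_map (μ := gaussianReal 0 1) hm.aemeasurable
  refine Measure.ext_of_Iic _ _ fun t => ?_
  rw [← measureReal_eq_measureReal_iff, map_measureReal_apply hm measurableSet_Iic, ← cdf_eq_real,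
    ← gaussianReal_Phi_le (cdf_nonneg ν t) (cdf_le_one ν t)]
  congr 1
  ext g
  exact gaussTransport_le_iff ν g t

/-- If the distribution function of `ν` is close to `Phi`, the monotone transport moves the points
of a bounded interval only slightly. -/
lemma abs_gaussTransport_sub_le (ν : Measure ℝ) [IsProbabilityMeasure ν] {ε δ M g : ℝ}
    (hν : ∀ t, |(ν (Iic t)).toReal - Phi t| ≤ ε) (hδ : 0 ≤ δ) (hδ1 : δ ≤ 1)
    (hε : ε ≤ δ * (Real.exp (-(M + 1) ^ 2 / 2) / 3)) (hg : |g| ≤ M) :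
    |gaussTransport ν g - g| ≤ δ := by
  have hF (t : ℝ) : |cdf ν t - Phi t| ≤ ε := by
    rw [cdf_eq_real]; exact hν t
  obtain ⟨hg1, hg2⟩ := abs_le.1 hg
  rw [abs_sub_le_iff]
  constructor
  · rw [sub_le_iff_le_add', gaussTransport_le_iff]
    have h1 := gaussianReal_real_Ioc_ge (a := g) (b := g + δ) (M := M + 1)
      (by linarith) (by linarith) (by linarith)
    rw [← Phi_sub_Phi (by linarith)] at h1
    have h2 := (abs_le.1 (hF (g + δ))).1
    have : (g + δ - g) * (Real.exp (-(M + 1) ^ 2 / 2) / 3) =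
      δ * (Real.exp (-(M + 1) ^ 2 / 2) / 3) := by ring
    linarith
  · rw [sub_le_comm]
    refine le_of_forall_lt fun t ht => ?_
    rw [← not_le, gaussTransport_le_iff, not_le]
    have h1 := gaussianReal_real_Ioc_ge (a := g - δ) (b := g) (M := M + 1)
      (by linarith) (by linarith) (by linarith)
    rw [← Phi_sub_Phi (by linarith)] at h1
    have h2 := (abs_le.1 (hF t)).2
    have h3 := Phi_strictMono ht
    have : (g - (g - δ)) * (Real.exp (-(M + 1) ^ 2 / 2) / 3) =
      δ * (Real.exp (-(M + 1) ^ 2 / 2) / 3) := by ring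
    linarith

open scoped RealInnerProductSpace

lemma sum_mul_eq_inner {m : ℕ} (v : EuclideanSpace ℝ (Fin m)) (r : Fin m → ℝ) :
    ∑ j, r j * v j = ⟪v, WithLp.toLp 2 r⟫ := by
  simp [PiLp.inner_apply]

lemma stdGaussian_map_inner {m : ℕ} {v : EuclideanSpace ℝ (Fin m)} (hv : ‖v‖ = 1) :
    (stdGaussian (EuclideanSpace ℝ (Fin m))).map (fun u => ⟪v, u⟫) = gaussianReal 0 1 := by
  have h := IsGaussian.map_eq_gaussianReal (μ := stdGaussian (EuclideanSpace ℝ (Fin m)))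
    (innerSL ℝ v)
  rw [integral_strongDual_stdGaussian, variance_dual_stdGaussian, innerSL_apply_norm, hv] at h
  simpa using h

lemma indepFun_inner_stdGaussian {m : ℕ} {w z : EuclideanSpace ℝ (Fin m)} (h : ⟪w, z⟫ = 0) :
    IndepFun (fun u => ⟪w, u⟫) (fun u => ⟪z, u⟫) (stdGaussian (EuclideanSpace ℝ (Fin m))) := by
  refine HasGaussianLaw.indepFun_of_covariance_eq_zero
    ((IsGaussian.hasGaussianLaw_id (μ := stdGaussian (EuclideanSpace ℝ (Fin m)))).map_fun
      ((innerSL ℝ w).prod (innerSL ℝ z))) ?_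
  have h2 := covarianceBilin_apply_eq_cov
    (IsGaussian.memLp_two_id (μ := stdGaussian (EuclideanSpace ℝ (Fin m)))) w z
  rw [covarianceBilin_stdGaussian] at h2
  exact h2.symm.trans h

lemma map_pi_gaussianReal_sum_mul {m : ℕ} {v : EuclideanSpace ℝ (Fin m)} (hv : ‖v‖ = 1) :
    (Measure.pi fun _ : Fin m => gaussianReal 0 1).map (fun r => ∑ j, r j * v j) =
      gaussianReal 0 1 := by
  have h := stdGaussian_map_inner hv
  rw [← map_pi_eq_stdGaussian, Measure.map_map (by fun_prop) (by fun_prop)] at h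
  refine Eq.trans ?_ h
  exact congrArg (fun f => Measure.map f (Measure.pi fun _ : Fin m => gaussianReal 0 1))
    (funext fun r => sum_mul_eq_inner v r)

/-- Both coordinates of a Gaussian row exceed `T` with probability of order `exp (-O(T ^ 2))`. -/
lemma pi_gaussianReal_real_both_gt_ge {m : ℕ} {x y : EuclideanSpace ℝ (Fin m)} {R a T : ℝ}
    (hR : 0 < R) (hR2 : R < 2) (hx : ‖x‖ = 1) (hy : ‖y‖ = 1) (hxy : ‖x - y‖ = R)
    (ha : a = √(4 - R ^ 2) / 2) (hT : 0 ≤ T) :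
    Real.exp (-((T + 1) / a + 1) ^ 2 / 2) / 3 * (Real.exp (-1 ^ 2 / 2) / 3) ≤
      (Measure.pi fun _ : Fin m => gaussianReal 0 1).real
        {r | T < ∑ j, r j * x j ∧ T < ∑ j, r j * y j} := by
  have h4 : 0 < 4 - R ^ 2 := by nlinarith
  have ha0 : 0 < a := by rw [ha]; have := Real.sqrt_pos.2 h4; positivity
  have hpar := parallelogram_law_with_norm ℝ x y
  have hsum : ‖x + y‖ = 2 * a := by
    rw [ha, mul_div_cancel₀ _ two_ne_zero, eq_comm, Real.sqrt_eq_iff_eq_sq h4.le (norm_nonneg _)]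
    rw [hx, hy, hxy] at hpar
    linarith
  set w : EuclideanSpace ℝ (Fin m) := (2 * a)⁻¹ • (x + y) with hw
  set z : EuclideanSpace ℝ (Fin m) := R⁻¹ • (x - y) with hz
  have hw1 : ‖w‖ = 1 := by
    rw [hw, norm_smul, hsum, Real.norm_of_nonneg (by positivity), inv_mul_cancel₀ (by positivity)]
  have hz1 : ‖z‖ = 1 := by
    rw [hz, norm_smul, hxy, Real.norm_of_nonneg (by positivity), inv_mul_cancel₀ (by positivity)]
  have hort : ⟪w, z⟫ = 0 := by
    rw [hw, hz, inner_smul_left, inner_smul_right,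
      (real_inner_add_sub_eq_zero_iff x y).2 (hx.trans hy.symm)]
    simp
  have hxw : x = a • w + (R / 2) • z := by
    rw [hw, hz, smul_smul, smul_smul]
    have h1 : a * (2 * a)⁻¹ = 2⁻¹ := by field_simp
    have h2 : R / 2 * R⁻¹ = 2⁻¹ := by field_simp
    rw [h1, h2]
    module
  have hyw : y = a • w - (R / 2) • z := by
    rw [hw, hz, smul_smul, smul_smul]
    have h1 : a * (2 * a)⁻¹ = 2⁻¹ := by field_simp
    have h2 : R / 2 * R⁻¹ = 2⁻¹ := by field_simp
    rw [h1, h2]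
    module
  set I : Set ℝ := Ioc ((T + 1) / a) ((T + 1) / a + 1) with hI
  have hT0 : 0 ≤ (T + 1) / a := by positivity
  have hpre : WithLp.toLp 2 ⁻¹' ((fun u => ⟪w, u⟫) ⁻¹' I ∩ (fun u => ⟪z, u⟫) ⁻¹' Ioc 0 1) ⊆
      {r : Fin m → ℝ | T < ∑ j, r j * x j ∧ T < ∑ j, r j * y j} := by
    rintro r ⟨⟨h1, -⟩, ⟨h3, h4'⟩⟩
    simp only at h1 h3 h4'
    rw [div_lt_iff₀ ha0] at h1
    simp only [mem_ofPred_eq, sum_mul_eq_inner]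
    rw [hxw, hyw, inner_add_left, inner_sub_left, real_inner_smul_left w _ a,
      real_inner_smul_left z _ (R / 2)]
    have h5 : R / 2 * ⟪z, WithLp.toLp 2 r⟫ ≤ 1 := by nlinarith
    have h6 : 0 < R / 2 * ⟪z, WithLp.toLp 2 r⟫ := by positivity
    constructor <;> linarith
  have hmw : Measurable fun u : EuclideanSpace ℝ (Fin m) => ⟪w, u⟫ := by fun_prop
  have hmz : Measurable fun u : EuclideanSpace ℝ (Fin m) => ⟪z, u⟫ := by fun_prop
  refine le_trans ?_ (measureReal_mono hpre)
  rw [← map_measureReal_apply (by fun_prop)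
    ((hmw measurableSet_Ioc).inter (hmz measurableSet_Ioc)), map_pi_eq_stdGaussian, measureReal_def,
    (indepFun_inner_stdGaussian hort).measure_inter_preimage_eq_mul _ _ measurableSet_Ioc
      measurableSet_Ioc, ENNReal.toReal_mul, ← measureReal_def, ← measureReal_def,
    ← map_measureReal_apply hmw measurableSet_Ioc, ← map_measureReal_apply hmz measurableSet_Ioc,
    stdGaussian_map_inner hw1, stdGaussian_map_inner hz1]
  have e1 := gaussianReal_real_Ioc_ge (a := (T + 1) / a) (b := (T + 1) / a + 1)
    (M := (T + 1) / a + 1) (by linarith) (by linarith) le_rfl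
  have e2 := gaussianReal_real_Ioc_ge (a := 0) (b := 1) (M := 1) (by norm_num) (by norm_num) le_rfl
  rw [add_sub_cancel_left, one_mul] at e1
  rw [sub_zero, one_mul] at e2
  gcongr

lemma pi_gaussianReal_real_both_abs_le_ge {m : ℕ} {x y : EuclideanSpace ℝ (Fin m)} {T : ℝ}
    (hx : ‖x‖ = 1) (hy : ‖y‖ = 1) (hT : 0 ≤ T) :
    1 - 4 * Real.exp (-T ^ 2 / 2) ≤ (Measure.pi fun _ : Fin m => gaussianReal 0 1).real
        {r | |∑ j, r j * x j| ≤ T ∧ |∑ j, r j * y j| ≤ T} := by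
  have hms (v : EuclideanSpace ℝ (Fin m)) :
      MeasurableSet {r : Fin m → ℝ | T < |∑ j, r j * v j|} :=
    measurableSet_lt measurable_const (by fun_prop)
  have key {v : EuclideanSpace ℝ (Fin m)} (hv : ‖v‖ = 1) :
      (Measure.pi fun _ : Fin m => gaussianReal 0 1).real {r | T < |∑ j, r j * v j|} ≤
        2 * Real.exp (-T ^ 2 / 2) := by
    have h := gaussianReal_real_abs_gt_le hT
    rwa [← map_pi_gaussianReal_sum_mul hv, map_measureReal_apply (by fun_prop)
      (measurableSet_lt measurable_const (by fun_prop))] at h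
  have hcompl : {r : Fin m → ℝ | |∑ j, r j * x j| ≤ T ∧ |∑ j, r j * y j| ≤ T} =
      ({r | T < |∑ j, r j * x j|} ∪ {r | T < |∑ j, r j * y j|})ᶜ := by
    ext r
    simp
  rw [hcompl, probReal_compl_eq_one_sub ((hms x).union (hms y))]
  have := measureReal_union_le (μ := Measure.pi fun _ : Fin m => gaussianReal 0 1)
    {r | T < |∑ j, r j * x j|} {r | T < |∑ j, r j * y j|}
  linarith [key hx, key hy]

instance isProbabilityMeasure_gaussMatrix (k m : ℕ) : IsProbabilityMeasure (gaussMatrix k m) := by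
  unfold gaussMatrix; infer_instance

/-- A lower bound for the collision probability from a single row on which both vectors are large
while they are small on all other rows. -/
lemma gaussMatrix_real_collide_ge {k m : ℕ} (i₀ : Fin k) (x y : Fin m → ℝ) (T : ℝ) :
    (Measure.pi fun _ : Fin m => gaussianReal 0 1).real
        {r | T < ∑ j, r j * x j ∧ T < ∑ j, r j * y j} *
      (Measure.pi fun _ : Fin m => gaussianReal 0 1).real
        {r | |∑ j, r j * x j| ≤ T ∧ |∑ j, r j * y j| ≤ T} ^ (k - 1) ≤
      (gaussMatrix k m).real {A | collide A x y} := by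
  set E : Set (Fin m → ℝ) := {r | T < ∑ j, r j * x j ∧ T < ∑ j, r j * y j}
  set K : Set (Fin m → ℝ) := {r | |∑ j, r j * x j| ≤ T ∧ |∑ j, r j * y j| ≤ T}
  have hsub : univ.pi (fun i => if i = i₀ then E else K) ⊆
      {A : Fin k → Fin m → ℝ | collide A x y} := by
    intro A hA
    have h0 : A i₀ ∈ E := by simpa using hA i₀ (mem_univ _)
    have h1 (j : Fin k) (hj : j ≠ i₀) : A j ∈ K := by simpa [hj] using hA j (mem_univ _)
    refine ⟨i₀, 1, Or.inl rfl, fun j hj => ?_, fun j hj => ?_⟩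
    · rw [one_mul]
      exact (h1 j hj).1.trans_lt h0.1
    · rw [one_mul]
      exact (h1 j hj).2.trans_lt h0.2
  refine le_trans (le_of_eq ?_) (measureReal_mono hsub)
  rw [gaussMatrix, measureReal_def (s := univ.pi _), Measure.pi_pi, ENNReal.toReal_prod,
    ← Finset.mul_prod_erase _ _ (Finset.mem_univ i₀), Finset.prod_congr rfl
      (g := fun _ => (Measure.pi fun _ : Fin m => gaussianReal 0 1).real K) fun i hi => by
        rw [if_neg (Finset.ne_of_mem_erase hi)]; rfl]
  simp [measureReal_def]

/-- Two coordinates of `A v` are rarely tied up to sign for a Gaussian matrix `A`. -/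
lemma gaussMatrix_real_abs_add_le {k m : ℕ} {v : EuclideanSpace ℝ (Fin m)} (hv : ‖v‖ = 1)
    {i l : Fin k} (hil : i ≠ l) {s η : ℝ} (hs : s ^ 2 = 1) (hη : 0 ≤ η) :
    (gaussMatrix k m).real {A | |mvMul A v i + s * mvMul A v l| ≤ η} ≤ 2 * η := by
  have hmap (i : Fin k) :
      (gaussMatrix k m).map (fun A => mvMul A v i) = gaussianReal 0 1 := by
    have h := map_pi_gaussianReal_sum_mul hv
    rw [← (measurePreserving_eval (fun _ : Fin k => Measure.pi fun _ : Fin m => gaussianReal 0 1)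
        i).map_eq, Measure.map_map (by fun_prop) (by fun_prop)] at h
    exact h
  have hind : IndepFun (fun A => mvMul A v i) (fun A => mvMul A v l) (gaussMatrix k m) :=
    (iIndepFun_pi (μ := fun _ : Fin k => Measure.pi fun _ : Fin m => gaussianReal 0 1)
      (X := fun _ r => ∑ j, r j * v j) (fun _ => Measurable.aemeasurable (by fun_prop))).indepFun hil
  have hm (i : Fin k) : Measurable fun A : Fin k → Fin m → ℝ => mvMul A v i := by
    unfold mvMul; fun_prop
  have hmap2 : (gaussMatrix k m).map (fun A => s * mvMul A v l) = gaussianReal 0 1 := by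
    have h := gaussianReal_map_const_mul (μ := 0) (v := 1) s
    rw [← hmap l, Measure.map_map (by fun_prop) (hm l)] at h
    refine h.trans ?_
    congr 1
    · simp
    · ext; simp [hs]
  have hadd := gaussianReal_add_gaussianReal_of_indepFun
    (hind.comp measurable_id (measurable_const_mul s)) (hmap i) hmap2
  have hle := gaussianReal_real_Icc_le (v := 1 + 1) le_self_add (neg_le_self hη)
  rw [← add_zero (0 : ℝ), ← hadd, map_measureReal_apply
    ((measurable_id.comp (hm i)).add ((measurable_const_mul s).comp (hm l))) measurableSet_Icc] at hle
  refine le_trans (measureReal_mono ?_) (hle.trans (by linarith))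
  intro A hA
  exact abs_le.1 hA

/-- Without near ties, a small perturbation of the coordinates does not change the hash. -/
lemma hashAt_congr_of_close {k m : ℕ} {A B : Fin k → Fin m → ℝ} {v : Fin m → ℝ} {η : ℝ}
    (hclose : ∀ i, |mvMul B v i - mvMul A v i| ≤ η)
    (hadd : ∀ i l, i ≠ l → 2 * η < |mvMul A v i + 1 * mvMul A v l|)
    (hsub : ∀ i l, i ≠ l → 2 * η < |mvMul A v i + -1 * mvMul A v l|)
    {s : ℝ} (hs : s = 1 ∨ s = -1) (i : Fin k) :
    hashAt B v i s ↔ hashAt A v i s := by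
  unfold hashAt
  refine forall₂_congr fun j hj => ?_
  obtain ⟨hi1, hi2⟩ := abs_le.1 (hclose i)
  obtain ⟨hj1, hj2⟩ := abs_le.1 (hclose j)
  rw [abs_lt, abs_lt]
  have ha := hadd i j hj.symm
  have hb := hsub i j hj.symm
  rw [lt_abs] at ha hb
  rcases hs with rfl | rfl <;> rcases ha with ha | ha <;> rcases hb with hb | hb <;>
    constructor <;> rintro ⟨h1, h2⟩ <;> constructor <;> linarith

lemma abs_mvMul_sub_le {k m : ℕ} {A B : Fin k → Fin m → ℝ} {v : EuclideanSpace ℝ (Fin m)} {δ : ℝ}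
    (hv : ‖v‖ = 1) (h : ∀ i j, |B i j - A i j| ≤ δ) (i : Fin k) :
    |mvMul B v i - mvMul A v i| ≤ m * δ := by
  unfold mvMul
  rw [← Finset.sum_sub_distrib]
  refine (Finset.abs_sum_le_sum_abs _ _).trans ?_
  calc ∑ j, |B i j * v j - A i j * v j| ≤ ∑ _j : Fin m, δ := by
        refine Finset.sum_le_sum fun j _ => ?_
        rw [← sub_mul, abs_mul]
        have h1 : |v j| ≤ 1 := by
          have := PiLp.norm_apply_le v j
          rwa [hv, Real.norm_eq_abs] at this
        exact (mul_le_of_le_one_right (abs_nonneg _) h1).trans (h i j)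
    _ = m * δ := by simp

lemma measurableSet_collide {k m : ℕ} (x y : Fin m → ℝ) :
    MeasurableSet {A : Fin k → Fin m → ℝ | collide A x y} := by
  have hm (v : Fin m → ℝ) (i : Fin k) : Measurable fun A : Fin k → Fin m → ℝ => mvMul A v i := by
    unfold mvMul; fun_prop
  have hh (v : Fin m → ℝ) (i : Fin k) (s : ℝ) :
      MeasurableSet {A : Fin k → Fin m → ℝ | hashAt A v i s} := by
    simp only [hashAt, ofPred_forall]
    exact MeasurableSet.iInter fun j => MeasurableSet.iInter fun _ =>
      measurableSet_lt (hm v j).abs ((hm v i).const_mul s)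
  have : {A : Fin k → Fin m → ℝ | collide A x y} =
      ⋃ i : Fin k, ({A | hashAt A x i 1} ∩ {A | hashAt A y i 1}) ∪
        ({A | hashAt A x i (-1)} ∩ {A | hashAt A y i (-1)}) := by
    ext A
    simp [collide, or_and_right, exists_or]
  rw [this]
  exact MeasurableSet.iUnion fun i =>
    ((hh x i 1).inter (hh y i 1)).union ((hh x i (-1)).inter (hh y i (-1)))

lemma gaussMatrix_real_abs_entry_gt_le {k m : ℕ} (i : Fin k) (j : Fin m) {M : ℝ} (hM : 0 ≤ M) :
    (gaussMatrix k m).real {A | M < |A i j|} ≤ 2 * Real.exp (-M ^ 2 / 2) := by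
  have h1 := measurePreserving_eval (fun _ : Fin k => Measure.pi fun _ : Fin m => gaussianReal 0 1) i
  have h2 := (measurePreserving_eval (fun _ : Fin m => gaussianReal 0 1) j).comp h1
  have h := gaussianReal_real_abs_gt_le hM
  rwa [← h2.map_eq, map_measureReal_apply h2.measurable
    (measurableSet_lt measurable_const (by fun_prop))] at h

/-- The set of matrices for which `A v` has two coordinates that nearly agree up to sign. -/
def nearTies (k m : ℕ) (v : Fin m → ℝ) (η : ℝ) : Set (Fin k → Fin m → ℝ) :=
  ⋃ p : Fin k × Fin k, {A | p.1 ≠ p.2 ∧ (|mvMul A v p.1 + 1 * mvMul A v p.2| ≤ η ∨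
    |mvMul A v p.1 + -1 * mvMul A v p.2| ≤ η)}

lemma gaussMatrix_real_nearTies_le {k m : ℕ} {v : EuclideanSpace ℝ (Fin m)} (hv : ‖v‖ = 1) {η : ℝ}
    (hη : 0 ≤ η) : (gaussMatrix k m).real (nearTies k m v η) ≤ k ^ 2 * (4 * η) := by
  refine (measureReal_iUnion_fintype_le _).trans ?_
  calc _ ≤ ∑ _p : Fin k × Fin k, 4 * η := by
        refine Finset.sum_le_sum fun p _ => ?_
        by_cases hp : p.1 = p.2
        · simpa [hp] using hη
        · simp only [ne_eq, hp, not_false_eq_true, true_and, ofPred_or]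
          refine (measureReal_union_le _ _).trans ?_
          linarith [gaussMatrix_real_abs_add_le hv hp (s := 1) (by norm_num) hη,
            gaussMatrix_real_abs_add_le hv hp (s := -1) (by norm_num) hη]
    _ = _ := by simp [sq]

/-- Replacing Gaussian entries by entries with a uniformly close distribution function changes the
collision probability only slightly. -/
lemma abs_collide_sub_collide_le {k m : ℕ} {x y : EuclideanSpace ℝ (Fin m)}
    (hx : ‖x‖ = 1) (hy : ‖y‖ = 1) (ν : Measure ℝ) [IsProbabilityMeasure ν] {ε δ M : ℝ}
    (hν : ∀ t, |(ν (Iic t)).toReal - Phi t| ≤ ε) (hδ : 0 ≤ δ) (hδ1 : δ ≤ 1)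
    (hε : ε ≤ δ * (Real.exp (-(M + 1) ^ 2 / 2) / 3)) (hM : 0 ≤ M) :
    |(Measure.pi fun _ : Fin k => Measure.pi fun _ : Fin m => ν).real {A | collide A x y} -
      (gaussMatrix k m).real {A | collide A x y}| ≤
      k * m * (2 * Real.exp (-M ^ 2 / 2)) + 16 * k ^ 2 * m * δ := by
  set F : (Fin k → Fin m → ℝ) → Fin k → Fin m → ℝ := fun A i j => gaussTransport ν (A i j) with hF
  have hFp : MeasurePreserving F (gaussMatrix k m)
      (Measure.pi fun _ : Fin k => Measure.pi fun _ : Fin m => ν) :=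
    measurePreserving_pi _ _ fun _ =>
      measurePreserving_pi _ _ fun _ => measurePreserving_gaussTransport ν
  set C : Set (Fin k → Fin m → ℝ) := {A | collide A x y} with hC
  set big : Set (Fin k → Fin m → ℝ) := ⋃ p : Fin k × Fin m, {A | M < |A p.1 p.2|} with hbig
  set bad : Set (Fin k → Fin m → ℝ) :=
    big ∪ (nearTies k m x (2 * (m * δ)) ∪ nearTies k m y (2 * (m * δ))) with hbad
  have hm : 0 ≤ m * δ := by positivity
  have hbadle : (gaussMatrix k m).real bad ≤
      k * m * (2 * Real.exp (-M ^ 2 / 2)) + 16 * k ^ 2 * m * δ := by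
    have h1 : (gaussMatrix k m).real big ≤ k * m * (2 * Real.exp (-M ^ 2 / 2)) := by
      refine (measureReal_iUnion_fintype_le _).trans ?_
      refine (Finset.sum_le_sum fun p _ => gaussMatrix_real_abs_entry_gt_le p.1 p.2 hM).trans ?_
      simp
    have h2 := gaussMatrix_real_nearTies_le (k := k) hx (η := 2 * (m * δ)) (by positivity)
    have h3 := gaussMatrix_real_nearTies_le (k := k) hy (η := 2 * (m * δ)) (by positivity)
    have h4 := measureReal_union_le (μ := gaussMatrix k m) big
      (nearTies k m x (2 * (m * δ)) ∪ nearTies k m y (2 * (m * δ)))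
    have h5 := measureReal_union_le (μ := gaussMatrix k m)
      (nearTies k m x (2 * (m * δ))) (nearTies k m y (2 * (m * δ)))
    calc _ ≤ k * m * (2 * Real.exp (-M ^ 2 / 2)) + (k ^ 2 * (4 * (2 * (m * δ))) +
          k ^ 2 * (4 * (2 * (m * δ)))) := by linarith
      _ = _ := by ring
  have hiff {A : Fin k → Fin m → ℝ} (hA : A ∉ bad) : F A ∈ C ↔ A ∈ C := by
    simp only [hbad, hbig, nearTies, mem_union, mem_iUnion, mem_ofPred_eq, not_or, not_exists,
      not_and, not_lt, not_le, Prod.forall] at hA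
    obtain ⟨hA1, hAx, hAy⟩ := hA
    have hcl (i : Fin k) (j : Fin m) : |F A i j - A i j| ≤ δ :=
      abs_gaussTransport_sub_le ν hν hδ hδ1 hε (hA1 i j)
    have hashx {s : ℝ} (hs : s = 1 ∨ s = -1) (i : Fin k) :=
      hashAt_congr_of_close (abs_mvMul_sub_le hx hcl) (fun i l h => (hAx i l h).1)
        (fun i l h => (hAx i l h).2) hs i
    have hashy {s : ℝ} (hs : s = 1 ∨ s = -1) (i : Fin k) :=
      hashAt_congr_of_close (abs_mvMul_sub_le hy hcl) (fun i l h => (hAy i l h).1)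
        (fun i l h => (hAy i l h).2) hs i
    exact exists₂_congr fun i s => and_congr_right fun hs =>
      and_congr (hashx hs i) (hashy hs i)
  rw [← hFp.measureReal_preimage (measurableSet_collide _ _).nullMeasurableSet]
  refine le_trans ?_ hbadle
  have h1 : (gaussMatrix k m).real (F ⁻¹' C) ≤
      (gaussMatrix k m).real C + (gaussMatrix k m).real bad := by
    refine (measureReal_mono fun A hA => ?_).trans (measureReal_union_le C bad)
    by_cases hb : A ∈ bad
    · exact Or.inr hb
    · exact Or.inl ((hiff hb).1 hA)
  have h2 : (gaussMatrix k m).real C ≤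
      (gaussMatrix k m).real (F ⁻¹' C) + (gaussMatrix k m).real bad := by
    refine (measureReal_mono fun A hA => ?_).trans (measureReal_union_le (F ⁻¹' C) bad)
    by_cases hb : A ∈ bad
    · exact Or.inr hb
    · exact Or.inl ((hiff hb).2 hA)
  rw [abs_sub_le_iff]
  constructor <;> linarith

/-- The perturbation error is super-polynomially small compared with the collision probability. -/
lemma perturbation_error_le {κ₁ κ₂ L : ℝ} (hκ₁ : 0 ≤ κ₁) (hκ₂ : 0 ≤ κ₂)
    (hL : 2 * (13 + κ₁ + κ₂) ≤ L) :
    Real.exp L * Real.exp L * (2 * Real.exp (-L ^ 2 / 2)) +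
        16 * Real.exp L ^ 2 * Real.exp L * (3 * Real.exp (-L ^ 2 + (L + 1) ^ 2 / 2)) ≤
      1 / 2 * (Real.exp (-(κ₁ * L + κ₂)) / 3 * (Real.exp (-1 ^ 2 / 2) / 3) * (1 / 2)) := by
  have hsq : (13 + κ₁ + κ₂) * L ≤ L ^ 2 / 2 := by nlinarith
  have hL1 : κ₂ + 9 ≤ (κ₂ + 9) * L := le_mul_of_one_le_right (by linarith) (by linarith)
  have h1 : Real.exp L * Real.exp L * (2 * Real.exp (-L ^ 2 / 2)) =
      2 * Real.exp (2 * L - L ^ 2 / 2) := by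
    rw [← Real.exp_add, mul_left_comm, ← Real.exp_add]
    ring_nf
  have h2 : 16 * Real.exp L ^ 2 * Real.exp L * (3 * Real.exp (-L ^ 2 + (L + 1) ^ 2 / 2)) =
      48 * Real.exp (4 * L + 1 / 2 - L ^ 2 / 2) := by
    have : 4 * L + 1 / 2 - L ^ 2 / 2 = L + L + L + (-L ^ 2 + (L + 1) ^ 2 / 2) := by ring
    rw [this]
    simp only [Real.exp_add]
    ring
  have h3 : Real.exp (2 * L - L ^ 2 / 2) ≤ Real.exp (4 * L + 1 / 2 - L ^ 2 / 2) :=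
    Real.exp_le_exp.2 (by linarith)
  have h4 : Real.exp (4 * L + 1 / 2 - L ^ 2 / 2) ≤
      Real.exp (-8) * (Real.exp (-(κ₁ * L + κ₂)) * Real.exp (-1 ^ 2 / 2)) := by
    rw [← Real.exp_add, ← Real.exp_add]
    exact Real.exp_le_exp.2 (by nlinarith)
  have h5 : Real.exp (-8) ≤ 1 / 1800 := by
    rw [Real.exp_neg, one_div]
    apply inv_anti₀ (by norm_num)
    have := Real.exp_one_gt_d9
    calc (1800 : ℝ) ≤ 2.7 ^ 8 := by norm_num
      _ ≤ Real.exp 1 ^ 8 := by gcongr; linarith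
      _ = Real.exp 8 := by rw [← Real.exp_nat_mul]; norm_num
  have h6 : 0 ≤ Real.exp (-(κ₁ * L + κ₂)) * Real.exp (-1 ^ 2 / 2) := by positivity
  have h7 := mul_le_mul_of_nonneg_right h5 h6
  rw [h1, h2]
  linarith

lemma abs_log_sub_log_le_one {p q : ℝ} (hq : 0 < q) (h : |p - q| ≤ 1 / 2 * q) :
    |Real.log p - Real.log q| ≤ 1 := by
  obtain ⟨h1, h2⟩ := abs_le.1 h
  have hp : 0 < p := by linarith
  have he : 2 ≤ Real.exp 1 := by linarith [Real.exp_one_gt_d9]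
  have hle {s t : ℝ} (hs : 0 < s) (ht : 0 < t) (hst : s ≤ 2 * t) : Real.log s - Real.log t ≤ 1 := by
    rw [← Real.log_div hs.ne' ht.ne', Real.log_le_iff_le_exp (div_pos hs ht), div_le_iff₀ ht]
    nlinarith
  rw [abs_sub_le_iff]
  exact ⟨hle hp hq (by linarith), hle hq hp (by linarith)⟩

lemma exp_neg_sq_eq (L : ℝ) :
    Real.exp (-L ^ 2) =
      3 * Real.exp (-L ^ 2 + (L + 1) ^ 2 / 2) * (Real.exp (-(L + 1) ^ 2 / 2) / 3) := by
  have h : -L ^ 2 = (-L ^ 2 + (L + 1) ^ 2 / 2) + -(L + 1) ^ 2 / 2 := by ring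
  conv_lhs => rw [h, Real.exp_add]
  ring

lemma three_mul_exp_le_one {L : ℝ} (hL : 5 ≤ L) :
    3 * Real.exp (-L ^ 2 + (L + 1) ^ 2 / 2) ≤ 1 := by
  have h3 : (3 : ℝ) ≤ Real.exp 2 := by linarith [Real.add_one_le_exp (2 : ℝ)]
  have hexp : Real.exp (-L ^ 2 + (L + 1) ^ 2 / 2) ≤ Real.exp (-2) :=
    Real.exp_le_exp.2 (by nlinarith)
  calc _ ≤ Real.exp 2 * Real.exp (-2) := by gcongr
    _ = 1 := by rw [← Real.exp_add]; simp

lemma exp_neg_le_exp_neg_sq_div_two {a L : ℝ} (hL : 0 ≤ L) :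
    Real.exp (-(4 / a ^ 2 * L + (1 / a + 1) ^ 2)) ≤
      Real.exp (-((2 * √L + 1) / a + 1) ^ 2 / 2) := by
  apply Real.exp_le_exp.2
  have e1 : (2 * √L + 1) / a + 1 = 2 / a * √L + (1 / a + 1) := by ring
  have e2 : 4 / a ^ 2 * L = (2 / a * √L) ^ 2 := by
    rw [mul_pow, Real.sq_sqrt hL, div_pow]
    norm_num
  rw [e1, e2]
  generalize 2 / a * √L = u
  generalize 1 / a + 1 = w
  linarith [add_sq u w, sub_sq u w, sq_nonneg (u - w)]

lemma half_le_pow {d p : ℝ} {n : ℕ} (hd : 8 ≤ d) (hn : (n : ℝ) ≤ d)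
    (hp : 1 - 4 * (d ^ 2)⁻¹ ≤ p) : 1 / 2 ≤ p ^ n := by
  have hd0 : 0 < d := by linarith
  have h4 : 4 * (d ^ 2)⁻¹ ≤ 1 := by
    rw [← div_eq_mul_inv, div_le_one (by positivity)]
    nlinarith
  have hbern := one_add_mul_le_pow (a := -(4 * (d ^ 2)⁻¹)) (by linarith) n
  have hsmall : (n : ℝ) * (4 * (d ^ 2)⁻¹) ≤ 1 / 2 := by
    calc _ ≤ d * (4 * (d ^ 2)⁻¹) := by gcongr
      _ = 4 / d := by field_simp
      _ ≤ 1 / 2 := by rw [div_le_div_iff₀ hd0 two_pos]; linarith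
  calc (1 / 2 : ℝ) ≤ (1 + -(4 * (d ^ 2)⁻¹)) ^ n := by linarith
    _ ≤ _ := pow_le_pow_left₀ (by linarith) (by linarith) _

/-- For unit vectors `x̃, ỹ ∈ ℝ^m` at distance `R̃ ∈ (0,2)`, with `m ≤ C₁(ln d)⁴` and
`m ≤ d' ≤ d` (`d` large), replacing the i.i.d. Gaussian entries of the `d' × m` hashing
matrix by i.i.d. entries whose CDF is within `d^{−ln d}` of the Gaussian CDF changes the
logarithm of the cross-polytope collision probability by at most a constant `C₂(R̃, C₁)`. -/
theorem stmt_7 (Rt : ℝ) (hRt : 0 < Rt) (hRt2 : Rt < 2) (C₁ : ℝ) (hC₁ : 0 < C₁) :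
    ∃ C₂ : ℝ, 0 < C₂ ∧ ∃ d₀ : ℕ, ∀ d : ℕ, d₀ ≤ d →
      ∀ m d' : ℕ, (m : ℝ) ≤ C₁ * (Real.log d) ^ 4 → m ≤ d' → d' ≤ d →
        ∀ xt yt : EuclideanSpace ℝ (Fin m), ‖xt‖ = 1 → ‖yt‖ = 1 → ‖xt - yt‖ = Rt →
          ∀ ν : Measure ℝ, IsProbabilityMeasure ν →
            (∀ t : ℝ, |(ν (Set.Iic t)).toReal - Phi t| ≤ (d : ℝ) ^ (-(Real.log d))) →
            |Real.log (((Measure.pi fun _ : Fin d' => Measure.pi fun _ : Fin m => ν)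
                  {A | collide A (fun i => xt i) (fun i => yt i)}).toReal) -
                Real.log ((gaussMatrix d' m
                  {A | collide A (fun i => xt i) (fun i => yt i)}).toReal)|
              ≤ C₂ := by
  set a : ℝ := √(4 - Rt ^ 2) / 2 with ha
  have ha0 : 0 < a := by
    have : 0 < √(4 - Rt ^ 2) := Real.sqrt_pos.2 (by nlinarith)
    positivity
  set κ₁ : ℝ := 4 / a ^ 2 with hκ₁
  set κ₂ : ℝ := (1 / a + 1) ^ 2 with hκ₂
  have hκ₁0 : 0 ≤ κ₁ := by positivity
  have hκ₂0 : 0 ≤ κ₂ := by positivity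
  refine ⟨1, one_pos, ⌈Real.exp (2 * (13 + κ₁ + κ₂))⌉₊, ?_⟩
  intro d hd m k _ hmk hkd x y hx hy hxy ν hνp hν
  have hdexp : Real.exp (2 * (13 + κ₁ + κ₂)) ≤ d := Nat.ceil_le.1 hd
  have hd0 : (0 : ℝ) < d := (Real.exp_pos _).trans_le hdexp
  set L : ℝ := Real.log d with hLdef
  have hL : 2 * (13 + κ₁ + κ₂) ≤ L := (Real.le_log_iff_exp_le hd0).2 hdexp
  have hdL : (d : ℝ) = Real.exp L := (Real.exp_log hd0).symm
  have hd8 : (8 : ℝ) ≤ d := by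
    rw [hdL]
    linarith [Real.add_one_le_exp L]
  have hm0 : 0 < m := by
    rcases Nat.eq_zero_or_pos m with rfl | h
    · rw [Subsingleton.elim x 0, norm_zero] at hx
      norm_num at hx
    · exact h
  have hk0 : 0 < k := hm0.trans_le hmk
  have hkd' : (k : ℝ) ≤ d := by exact_mod_cast hkd
  have hmd' : (m : ℝ) ≤ d := by exact_mod_cast hmk.trans hkd
  have hε : (d : ℝ) ^ (-L) = Real.exp (-L ^ 2) := by
    rw [Real.rpow_def_of_pos hd0, ← hLdef]
    ring_nf
  have hδ1 := three_mul_exp_le_one (L := L) (by linarith)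
  have hdiff := abs_collide_sub_collide_le (k := k) hx hy ν (M := L) hν
    (δ := 3 * Real.exp (-L ^ 2 + (L + 1) ^ 2 / 2)) (by positivity) hδ1 (by
      rw [hε]
      exact (exp_neg_sq_eq L).le) (by linarith)
  have hrow := pi_gaussianReal_real_both_gt_ge hRt hRt2 hx hy hxy ha
    (T := 2 * √L) (by positivity)
  have hrest := pi_gaussianReal_real_both_abs_le_ge hx hy (T := 2 * √L) (by positivity)
  have hsqrt : √L ^ 2 = L := Real.sq_sqrt (by linarith)
  have hexp2 : Real.exp (-(2 * √L) ^ 2 / 2) = ((d : ℝ) ^ 2)⁻¹ := by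
    rw [mul_pow, hsqrt, hdL, ← Real.exp_nat_mul, ← Real.exp_neg]
    congr 1
    push_cast
    ring
  have hS : Real.exp (-(κ₁ * L + κ₂)) ≤ Real.exp (-((2 * √L + 1) / a + 1) ^ 2 / 2) :=
    exp_neg_le_exp_neg_sq_div_two (by linarith)
  have hpow : (1 / 2 : ℝ) ≤ (Measure.pi fun _ : Fin m => gaussianReal 0 1).real
      {r | |∑ j, r j * x j| ≤ 2 * √L ∧ |∑ j, r j * y j| ≤ 2 * √L} ^ (k - 1) := by
    rw [hexp2] at hrest
    exact half_le_pow hd8 (le_trans (by exact_mod_cast Nat.sub_le k 1) hkd') hrest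
  have hlow : Real.exp (-(κ₁ * L + κ₂)) / 3 * (Real.exp (-1 ^ 2 / 2) / 3) * (1 / 2) ≤
      (gaussMatrix k m).real {A | collide A (fun i => x i) (fun i => y i)} := by
    refine le_trans ?_ (gaussMatrix_real_collide_ge ⟨0, hk0⟩ (fun i => x i) (fun i => y i) (2 * √L))
    refine mul_le_mul (le_trans ?_ hrow) hpow (by norm_num) measureReal_nonneg
    gcongr
  refine abs_log_sub_log_le_one (lt_of_lt_of_le (by positivity) hlow) (hdiff.trans ?_)
  calc _ ≤ Real.exp L * Real.exp L * (2 * Real.exp (-L ^ 2 / 2)) +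
        16 * Real.exp L ^ 2 * Real.exp L * (3 * Real.exp (-L ^ 2 + (L + 1) ^ 2 / 2)) := by
        rw [← hdL]
        gcongr
    _ ≤ _ := perturbation_error_le hκ₁0 hκ₂0 hL
    _ ≤ _ := mul_le_mul_of_nonneg_left hlow (by norm_num)
end

section
/- Let m ≥ 1 be an integer and δ ≥ 0. For i = 1,…,m let μ_i be the standard Gaussian measure N(0,1) on ℝ and let ν_i be a Borel probability measure on ℝ whose CDF satisfies sup_{t∈ℝ} |ν_i((−∞, t]) − Φ(t)| ≤ δ. Then for every convex Borel-measurable set K ⊆ ℝ^m, | (μ_1 ⊗ ⋯ ⊗ μ_m)(K) − (ν_1 ⊗ ⋯ ⊗ ν_m)(K) | ≤ 2mδ. -/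
open MeasureTheory ProbabilityTheory

/-- A uniform bound on the difference of two CDFs extends to all lower sets of the line. -/
lemma abs_measureReal_sub_le_of_isLowerSet {μ ν : Measure ℝ} [IsProbabilityMeasure μ]
    [IsProbabilityMeasure ν] {δ : ℝ} (h : ∀ t, |μ.real (Set.Iic t) - ν.real (Set.Iic t)| ≤ δ)
    {L : Set ℝ} (hL : IsLowerSet L) : |μ.real L - ν.real L| ≤ δ := by
  have hδ : 0 ≤ δ := (abs_nonneg _).trans (h 0)
  rcases L.eq_empty_or_nonempty with rfl | hne
  · simpa using hδ
  by_cases hb : BddAbove L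
  · have hlub := isLUB_csSup hne hb
    set a := sSup L
    by_cases ha : a ∈ L
    · rw [(hL.Iic_subset ha).antisymm' fun x hx => hlub.1 hx]
      exact h a
    · have hLa : L = Set.Iio a := by
        ext x
        refine ⟨fun hx => (hlub.1 hx).lt_of_ne (by rintro rfl; exact ha hx), fun hx => ?_⟩
        obtain ⟨y, hy, hxy, -⟩ := hlub.exists_between hx
        exact hL hxy.le hy
      obtain ⟨u, humono, hult, hutend⟩ := exists_seq_strictMono_tendsto a
      have hlim (ρ : Measure ℝ) [IsProbabilityMeasure ρ] :
          Filter.Tendsto (fun n => ρ.real (Set.Iic (u n))) Filter.atTop (nhds (ρ.real L)) := by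
        rw [hLa, ← iUnion_Iic_eq_Iio_of_lt_of_tendsto hult hutend]
        exact (ENNReal.tendsto_toReal (measure_ne_top _ _)).comp
          (tendsto_measure_iUnion_atTop fun i j hij => Set.Iic_subset_Iic.2 (humono.monotone hij))
      exact le_of_tendsto ((hlim μ).sub (hlim ν)).abs (.of_forall fun n => h (u n))
  · have hLuniv : L = Set.univ := Set.eq_univ_of_forall fun x => by
      obtain ⟨y, hy, hxy⟩ := not_bddAbove_iff.1 hb x
      exact hL hxy.le hy
    simpa [hLuniv] using hδ

/-- If two distributions on the line have CDFs within `δ`, their values on any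
order-connected set differ by at most `2δ`. -/
lemma abs_measureReal_sub_le_of_ordConnected {μ ν : Measure ℝ} [IsProbabilityMeasure μ]
    [IsProbabilityMeasure ν] {δ : ℝ} (h : ∀ t, |μ.real (Set.Iic t) - ν.real (Set.Iic t)| ≤ δ)
    {S : Set ℝ} (hS : S.OrdConnected) : |μ.real S - ν.real S| ≤ 2 * δ := by
  let L : Set ℝ := {x | ∃ y ∈ S, x ≤ y}
  let M : Set ℝ := {x | x ∈ L ∧ x ∉ S}
  have hL : IsLowerSet L := fun x y hyx ⟨z, hz, hxz⟩ => ⟨z, hz, hyx.trans hxz⟩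
  have hM : IsLowerSet M := by
    rintro x y hyx ⟨hxL, hxS⟩
    refine ⟨hL hyx hxL, fun hyS => hxS ?_⟩
    obtain ⟨z, hz, hxz⟩ := hxL
    exact hS.out hyS hz ⟨hyx, hxz⟩
  have hdiff : S = L \ M := by
    ext x
    refine ⟨fun hx => ⟨⟨x, hx, le_rfl⟩, fun hxM => hxM.2 hx⟩, fun ⟨hxL, hxM⟩ => ?_⟩
    by_contra hx
    exact hxM ⟨hxL, hx⟩
  have hML : M ⊆ L := fun x hx => hx.1
  have hMm : MeasurableSet M := hM.ordConnected.measurableSet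
  have hl := abs_le.1 (abs_measureReal_sub_le_of_isLowerSet h hL)
  have hm := abs_le.1 (abs_measureReal_sub_le_of_isLowerSet h hM)
  rw [hdiff, measureReal_sdiff hML hMm, measureReal_sdiff hML hMm, abs_le]
  constructor <;> linarith

/-- Two product measures whose factors are close on all sections of a set are close on that set. -/
lemma abs_prod_measureReal_sub_le {α β : Type*} [MeasurableSpace α] [MeasurableSpace β]
    {μ₁ ν₁ : Measure α} {μ₂ ν₂ : Measure β} [IsProbabilityMeasure μ₁] [IsProbabilityMeasure ν₁]
    [IsProbabilityMeasure μ₂] [IsProbabilityMeasure ν₂] {a b : ℝ} {T : Set (α × β)}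
    (hT : MeasurableSet T)
    (h₁ : ∀ y, |μ₁.real ((fun x => (x, y)) ⁻¹' T) - ν₁.real ((fun x => (x, y)) ⁻¹' T)| ≤ a)
    (h₂ : ∀ x, |μ₂.real (Prod.mk x ⁻¹' T) - ν₂.real (Prod.mk x ⁻¹' T)| ≤ b) :
    |(μ₁.prod μ₂).real T - (ν₁.prod ν₂).real T| ≤ a + b := by
  simp only [← Real.norm_eq_abs] at h₁ h₂
  have hleft (ρ : Measure α) (σ : Measure β) [IsProbabilityMeasure ρ] [IsProbabilityMeasure σ] :
      Integrable (fun x => σ.real (Prod.mk x ⁻¹' T)) ρ ∧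
        (ρ.prod σ).real T = ∫ x, σ.real (Prod.mk x ⁻¹' T) ∂ρ := by
    refine ⟨Measure.integrable_measure_prodMk_left hT (measure_ne_top _ _), ?_⟩
    rw [measureReal_def, Measure.prod_apply hT]
    exact (integral_toReal (measurable_measure_prodMk_left hT).aemeasurable
      (.of_forall fun _ => measure_lt_top _ _)).symm
  have hright (ρ : Measure α) (σ : Measure β) [IsProbabilityMeasure ρ] [IsProbabilityMeasure σ] :
      Integrable (fun y => ρ.real ((fun x => (x, y)) ⁻¹' T)) σ ∧
        (ρ.prod σ).real T = ∫ y, ρ.real ((fun x => (x, y)) ⁻¹' T) ∂σ := by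
    have hmeas := measurable_measure_prodMk_right (μ := ρ) hT
    refine ⟨Integrable.of_bound hmeas.ennreal_toReal.aestronglyMeasurable 1
      (.of_forall fun y => ?_), ?_⟩
    · rw [Real.norm_of_nonneg measureReal_nonneg]
      exact measureReal_le_one
    · rw [measureReal_def, Measure.prod_apply_symm hT]
      exact (integral_toReal hmeas.aemeasurable (.of_forall fun _ => measure_lt_top _ _)).symm
  have hsnd : |(μ₁.prod μ₂).real T - (μ₁.prod ν₂).real T| ≤ b := by
    rw [(hleft μ₁ μ₂).2, (hleft μ₁ ν₂).2, ← integral_sub (hleft μ₁ μ₂).1 (hleft μ₁ ν₂).1,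
      ← Real.norm_eq_abs]
    simpa only [probReal_univ, mul_one] using
      norm_integral_le_of_norm_le_const (μ := μ₁) (.of_forall h₂)
  have hfst : |(μ₁.prod ν₂).real T - (ν₁.prod ν₂).real T| ≤ a := by
    rw [(hright μ₁ ν₂).2, (hright ν₁ ν₂).2, ← integral_sub (hright μ₁ ν₂).1 (hright ν₁ ν₂).1,
      ← Real.norm_eq_abs]
    simpa only [probReal_univ, mul_one] using
      norm_integral_le_of_norm_le_const (μ := ν₂) (.of_forall h₁)
  linarith [abs_sub_le ((μ₁.prod μ₂).real T) ((μ₁.prod ν₂).real T) ((ν₁.prod ν₂).real T)]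

/-- Product measures whose factors have CDFs within `δ` differ by at most `2mδ` on
convex measurable sets. -/
lemma abs_pi_measureReal_sub_le_of_convex {δ : ℝ} {m : ℕ} (μ ν : Fin m → Measure ℝ)
    [∀ i, IsProbabilityMeasure (μ i)] [∀ i, IsProbabilityMeasure (ν i)]
    (h : ∀ i t, |(μ i).real (Set.Iic t) - (ν i).real (Set.Iic t)| ≤ δ)
    {K : Set (Fin m → ℝ)} (hconv : Convex ℝ K) (hmeas : MeasurableSet K) :
    |(Measure.pi μ).real K - (Measure.pi ν).real K| ≤ 2 * m * δ := by
  induction m with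
  | zero => simp [Measure.pi_of_empty μ, Measure.pi_of_empty ν]
  | succ m ih =>
    let e := MeasurableEquiv.piFinSuccAbove (fun _ : Fin (m + 1) => ℝ) 0
    have hpi (ρ : Fin (m + 1) → Measure ℝ) [∀ i, IsProbabilityMeasure (ρ i)] :
        (Measure.pi ρ).real K =
          ((ρ 0).prod (Measure.pi fun j => ρ (Fin.succAbove 0 j))).real (e.symm ⁻¹' K) := by
      rw [measureReal_def, measureReal_def,
        (measurePreserving_piFinSuccAbove ρ 0).symm.measure_preimage_equiv]
    have hcomb (x y : ℝ) (v w : Fin m → ℝ) (a b : ℝ) :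
        e.symm (a • x + b • y, a • v + b • w) = a • e.symm (x, v) + b • e.symm (y, w) := by
      funext i
      refine Fin.cases ?_ (fun j => ?_) i <;> simp [e, MeasurableEquiv.piFinSuccAbove]
    rw [hpi μ, hpi ν]
    refine (abs_prod_measureReal_sub_le (a := 2 * δ) (b := 2 * m * δ)
      (e.symm.measurable hmeas) (fun v => ?_) fun x => ?_).trans_eq (by push_cast; ring)
    · refine abs_measureReal_sub_le_of_ordConnected (h 0) (Convex.ordConnected ?_)
      intro x hx y hy a b ha hb hab
      have hmem := hconv hx hy ha hb hab
      rwa [← hcomb, Convex.combo_self hab] at hmem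
    · refine ih _ _ (fun i => h _) ?_ (measurable_prodMk_left (e.symm.measurable hmeas))
      intro v hv w hw a b ha hb hab
      have hmem := hconv hv hw ha hb hab
      rwa [← hcomb, Convex.combo_self hab] at hmem

/-- If each `ν i` is a Borel probability measure on `ℝ` whose CDF is uniformly within `δ`
of the standard Gaussian CDF, then the product measure `ν₁ ⊗ ⋯ ⊗ ν_m` and the standard
Gaussian product measure assign, to every convex measurable set `K ⊆ ℝ^m`, probabilities
that differ by at most `2mδ`. -/
theorem stmt_9 (m : ℕ) (hm : 1 ≤ m) (δ : ℝ) (hδ : 0 ≤ δ)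
    (ν : Fin m → Measure ℝ) (hprob : ∀ i, IsProbabilityMeasure (ν i))
    (hcdf : ∀ i t, |((ν i) (Set.Iic t)).toReal - Phi t| ≤ δ)
    (K : Set (Fin m → ℝ)) (hconv : Convex ℝ K) (hmeas : MeasurableSet K) :
    |((Measure.pi fun _ : Fin m => gaussianReal 0 1) K).toReal - (Measure.pi ν K).toReal|
      ≤ 2 * m * δ := by
  exact abs_pi_measureReal_sub_le_of_convex (fun _ => gaussianReal 0 1) ν
    (fun i t => by rw [abs_sub_comm]; exact hcdf i t) hconv hmeas
end
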